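/- Let T(ω,ξ,y)=(θω, g_ω(ξ), h_{ω,ξ}(y)) be a random map on Ω×Ξ×ℝ^d as in the double skew product setting, and let K be a T-invariant random compact set with connected fibres (K(ω,ξ) connected for P-a.e. ω and all ξ∈Ξ). Suppose that for all k∈ℕ and all ε>0 there is r>0 such that sup{Φ_k(ω,ξ,y) : ω∈Ω, (ξ,y)∈B_r(K(ω))} ≤ sup{Φ_k(ω,ξ,y) : ω∈Ω, (ξ,y)∈K(ω)} + ε, and that λ(μ,T)<0 for all μ∈M_P^K(T). Then for P-a.e. ω∈Ω the fibre K(ω) consists of a single continuous graph: there is a function φ:Ω×Ξ→ℝ^d, measurable in ω and continuous in ξ, such that K(ω)={(ξ,φ(ω,ξ)) : ξ∈Ξ} for P-a.e. ω∈Ω. -/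

import Mathlib

open MeasureTheory Metric Filter

/-- Iterates of the deterministic-forcing fibre maps:
`giter θ g n ω = g_{θ^{n-1}ω} ∘ ⋯ ∘ g_ω`. -/
def giter {Ω Ξ : Type*} (θ : Ω → Ω) (g : Ω → Ξ → Ξ) : ℕ → Ω → Ξ → Ξ
  | 0 => fun _ ξ => ξ
  | n + 1 => fun ω ξ => g (θ^[n] ω) (giter θ g n ω ξ)

/-- Iterates of the fibre maps in the last coordinate along the orbit of `(ω,ξ)`
under `θ ⋉ g`: `hiter θ g h n ω ξ = h^n_{ω,ξ}`. -/
noncomputable def hiter {Ω Ξ E : Type*} (θ : Ω → Ω) (g : Ω → Ξ → Ξ)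
    (h : Ω → Ξ → E → E) : ℕ → Ω → Ξ → E → E
  | 0 => fun _ _ y => y
  | n + 1 => fun ω ξ y => h (θ^[n] ω) (giter θ g n ω ξ) (hiter θ g h n ω ξ y)

section Helpers
open Topology

theorem komlos_aux {H : Type*} [NormedAddCommGroup H] [InnerProductSpace ℝ H] (v : ℕ → H)
    (B : ℝ) (hB : ∀ n, ‖v n‖ ≤ B) :
    ∃ w : ℕ → H, (∀ n, w n ∈ convexHull ℝ (v '' Set.Ici n)) ∧ CauchySeq w := by
  set C : ℕ → Set H := fun n => convexHull ℝ (v '' Set.Ici n) with hC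
  have hCne : ∀ n, v n ∈ C n := fun n => subset_convexHull ℝ _ ⟨n, Set.mem_Ici.2 le_rfl, rfl⟩
  have hCanti : ∀ n m, n ≤ m → C m ⊆ C n := fun n m h =>
    convexHull_mono (Set.image_mono (Set.Ici_subset_Ici.2 h))
  set D : ℕ → ℝ := fun n => sInf (norm '' C n) with hD
  have hbdd : ∀ n, BddBelow (norm '' C n) := fun n => ⟨0, by rintro _ ⟨x, -, rfl⟩; exact norm_nonneg x⟩
  have hDle : ∀ n x, x ∈ C n → D n ≤ ‖x‖ := fun n x hx => csInf_le (hbdd n) ⟨x, hx, rfl⟩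
  have hD0 : ∀ n, 0 ≤ D n := fun n => Real.sInf_nonneg (by rintro _ ⟨x, -, rfl⟩; exact norm_nonneg x)
  have hDB : ∀ n, D n ≤ B := fun n => (hDle n _ (hCne n)).trans (hB n)
  have hmono : Monotone D := fun n m h => 
    csInf_le_csInf (hbdd n) ⟨_, _, hCne m, rfl⟩ (Set.image_mono (hCanti n m h))
  have hex : ∀ n, ∃ w ∈ C n, ‖w‖ < D n + 1 / ((n : ℝ) + 1) := by
    intro n
    obtain ⟨_, ⟨w, hw, rfl⟩, h⟩ := exists_lt_of_csInf_lt (s := norm '' C n) ⟨_, _, hCne n, rfl⟩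
      (show sInf (norm '' C n) < D n + 1 / ((n : ℝ) + 1) by
        have : (0:ℝ) < 1 / ((n : ℝ) + 1) := by positivity
        simp only [hD]; linarith)
    exact ⟨w, hw, h⟩
  choose w hw hwn using hex
  refine ⟨w, hw, ?_⟩
  have hlim : Tendsto D atTop (𝓝 (⨆ n, D n)) :=
    tendsto_atTop_ciSup hmono ⟨B, by rintro _ ⟨n, rfl⟩; exact hDB n⟩
  set S := ⨆ n, D n with hS
  have hDS : ∀ n, D n ≤ S := fun n => le_ciSup (f := D) ⟨B, by rintro _ ⟨n, rfl⟩; exact hDB n⟩ n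
  have key : ∀ n m, n ≤ m → ‖w n - w m‖ ^ 2 ≤ 4 * (S + 1 / ((n : ℝ) + 1)) ^ 2 - 4 * (D n) ^ 2 := by
    intro n m h
    have h1 : ‖w n + w m‖ ≥ 2 * D n := by
      have hmem : (1/2 : ℝ) • w n + (1/2 : ℝ) • w m ∈ C n :=
        convex_convexHull ℝ _ (hw n) (hCanti n m h (hw m)) (by norm_num) (by norm_num) (by norm_num)
      have := hDle n _ hmem
      rw [← smul_add, norm_smul] at this
      norm_num at this
      linarith
    have h2 := parallelogram_law_with_norm ℝ (w n) (w m)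
    have h3 : ‖w n‖ ≤ S + 1 / ((n : ℝ) + 1) := by linarith [hwn n, hDS n]
    have h4 : ‖w m‖ ≤ S + 1 / ((n : ℝ) + 1) := by
      have : 1 / ((m : ℝ) + 1) ≤ 1 / ((n : ℝ) + 1) := by
        apply one_div_le_one_div_of_le (by positivity)
        have : (n : ℝ) ≤ m := by exact_mod_cast h
        linarith
      linarith [hwn m, hDS m]
    have h5 : ‖w n‖ ^ 2 ≤ (S + 1 / ((n : ℝ) + 1)) ^ 2 := by gcongr
    have h6 : ‖w m‖ ^ 2 ≤ (S + 1 / ((n : ℝ) + 1)) ^ 2 := by gcongr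
    have h7 : (2 * D n) ^ 2 ≤ ‖w n + w m‖ ^ 2 := by
      have := hD0 n
      gcongr
    nlinarith
  have hz : Tendsto (fun n : ℕ => Real.sqrt (4 * (S + 1 / ((n : ℝ) + 1)) ^ 2 - 4 * (D n) ^ 2)) atTop (𝓝 0) := by
    have h1 : Tendsto (fun n : ℕ => 1 / ((n : ℝ) + 1)) atTop (𝓝 0) := tendsto_one_div_add_atTop_nhds_zero_nat
    have h2 := (((h1.const_add S).pow 2).const_mul 4).sub ((hlim.pow 2).const_mul 4)
    have h3 := (Real.continuous_sqrt.tendsto _).comp h2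
    simpa [Function.comp_def] using h3
  refine cauchySeq_of_le_tendsto_0' _ ?_ hz
  intro n m h
  rw [dist_eq_norm]
  exact Real.le_sqrt_of_sq_le (key n m h)


/-- Pointwise step: tightness plus convergence on a dense family gives a limit measure. -/
theorem exists_limit_measure {X : Type*} [MetricSpace X] [ProperSpace X] [MeasurableSpace X]
    [BorelSpace X] (ν : ℕ → Measure X) (hν : ∀ n, IsProbabilityMeasure (ν n)) (Q : Set X) (hQ : IsCompact Q)
    (hνQ : ∀ n, ν n Qᶜ = 0) (f : ℕ → C(X, ℝ)) (hf : DenseRange f)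
    (hconv : ∀ i, ∃ l : ℝ, Tendsto (fun n => ∫ x, max (-1) (min (f i x) 1) ∂(ν n)) atTop (𝓝 l)) :
    ∃ ν' : Measure X, IsProbabilityMeasure ν' ∧ ∀ F : X → ℝ, Continuous F → (∃ B, ∀ x, |F x| ≤ B) →
      Tendsto (fun n => ∫ x, F x ∂(ν n)) atTop (𝓝 (∫ x, F x ∂ν')) := by
  have hInt0 : ∀ (n : ℕ) (G : X → ℝ), Continuous G → (∃ B, ∀ x, |G x| ≤ B) → Integrable G (ν n) := by
    rintro n G hG ⟨B, hB⟩
    exact Integrable.of_bound hG.aestronglyMeasurable B (ae_of_all _ hB)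
  have h1 : ∀ F : X → ℝ, Continuous F → (∀ x, |F x| ≤ 1) → CauchySeq (fun n => ∫ x, F x ∂(ν n)) := by
    intro F hF hF1
    rw [Metric.cauchySeq_iff']
    intro ε hε
    have hopen : ∃ i, ∀ x ∈ Q, |f i x - F x| < ε / 4 := by
      have := hf.exists_mem_open (s := {u : C(X, ℝ) | ∀ x ∈ Q, |u x - F x| < ε / 4}) ?_ ?_
      · obtain ⟨i, hi⟩ := this; exact ⟨i, hi⟩
      · have hh : IsOpen {u : C(X, ℝ) | Set.MapsTo (u - ⟨F, hF⟩ : C(X, ℝ)) Q (Metric.ball 0 (ε / 4))} := by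
          have := ContinuousMap.isOpen_setOfPred_mapsTo (X := X) (Y := ℝ) hQ (Metric.isOpen_ball (x := (0:ℝ)) (ε := ε/4))
          exact this.preimage (continuous_id.sub continuous_const)
        convert hh using 2
        ext u
        simp [Set.MapsTo]
      · exact ⟨⟨F, hF⟩, by intro x _; simp; positivity⟩
    obtain ⟨i, hi⟩ := hopen
    set G : X → ℝ := fun x => max (-1) (min (f i x) 1) with hG
    have hGc : Continuous G := continuous_const.max ((f i).continuous.min continuous_const)
    have hGb : ∀ x, |G x| ≤ 1 := fun x => abs_le.2 ⟨le_max_left _ _, max_le (by norm_num) (min_le_right _ _)⟩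
    have hGF : ∀ x ∈ Q, |F x - G x| ≤ ε / 4 := by
      intro x hx
      have h1 := abs_lt.1 (hi x hx)
      have h2 := abs_le.1 (hF1 x)
      rw [abs_le]
      simp only [hG]
      rcases max_cases (-1 : ℝ) (min (f i x) 1) with h | h <;> rcases min_cases (f i x) 1 with h' | h' <;>
        constructor <;> linarith
    have hdiff : ∀ n, |∫ x, F x ∂(ν n) - ∫ x, G x ∂(ν n)| ≤ ε / 4 := by
      intro n
      rw [← integral_sub (hInt0 n F hF ⟨1, hF1⟩) (hInt0 n G hGc ⟨1, hGb⟩)]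
      have := norm_integral_le_of_norm_le_const (μ := ν n) (f := fun x => F x - G x) (C := ε / 4) ?_
      · simpa using this
      · have : ∀ᵐ x ∂(ν n), x ∈ Q := by
          rw [ae_iff]; exact hνQ n
        filter_upwards [this] with x hx using hGF x hx
    obtain ⟨l, hl⟩ := hconv i
    obtain ⟨N, hN⟩ := Metric.cauchySeq_iff'.1 hl.cauchySeq (ε / 4) (by positivity)
    refine ⟨N, fun n hn => ?_⟩
    have h2 := hN n hn
    rw [Real.dist_eq] at h2 ⊢
    have h3 := abs_le.1 (hdiff n)
    have h4 := abs_le.1 (hdiff N)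
    have h5 := abs_lt.1 h2
    rw [abs_lt]; constructor <;> linarith
  have h2 : ∀ F : X → ℝ, Continuous F → (∃ B, ∀ x, |F x| ≤ B) → ∃ l, Tendsto (fun n => ∫ x, F x ∂(ν n)) atTop (𝓝 l) := by
    rintro F hF ⟨B, hB⟩
    have hB' : (0:ℝ) < |B| + 1 := by positivity
    have := h1 (fun x => F x / (|B| + 1)) (hF.div_const _) (fun x => by
      rw [abs_div, abs_of_pos hB', div_le_one hB']
      linarith [hB x, le_abs_self B])
    obtain ⟨l, hl⟩ := cauchySeq_tendsto_of_complete this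
    refine ⟨l * (|B| + 1), ?_⟩
    have := hl.mul_const (|B| + 1)
    refine this.congr (fun n => ?_)
    rw [integral_div]
    field_simp
  let p : ℕ → ProbabilityMeasure X := fun n => ⟨ν n, hν n⟩
  have htight : IsTightMeasureSet {x : Measure X | ∃ μ ∈ Set.range p, (μ : Measure X) = x} := by
    rw [isTightMeasureSet_iff_exists_isCompact_measure_compl_le]
    intro ε hε
    refine ⟨Q, hQ, ?_⟩
    rintro _ ⟨_, ⟨n, rfl⟩, rfl⟩
    show ν n Qᶜ ≤ ε
    rw [hνQ n]; exact zero_le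
  have hcomp := isCompact_closure_of_isTightMeasureSet htight
  obtain ⟨μ, -, hμ⟩ := hcomp.exists_mapClusterPt (u := p) (f := atTop) (by
    simp only [le_principal_iff, mem_map]
    exact univ_mem' (fun n => subset_closure ⟨n, rfl⟩))
  refine ⟨μ, inferInstance, ?_⟩
  rintro F hF ⟨B, hB⟩
  obtain ⟨l, hl⟩ := h2 F hF ⟨B, hB⟩
  let Fb : BoundedContinuousFunction X ℝ := BoundedContinuousFunction.ofNormedAddCommGroup F hF B hB
  have hcl := hμ.continuousAt_comp (f := fun μ : ProbabilityMeasure X => ∫ x, Fb x ∂(μ : Measure X))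
    (ProbabilityMeasure.continuous_integral_boundedContinuousFunction Fb).continuousAt
  have : (∫ x, F x ∂(μ : Measure X)) = l := by
    have hl' : Tendsto ((fun μ : ProbabilityMeasure X => ∫ x, Fb x ∂(μ : Measure X)) ∘ p) atTop (𝓝 l) := hl
    by_contra hne
    have := hcl.frequently (isOpen_ne.mem_nhds (Ne.symm (Ne.symm hne)))
    obtain ⟨U, V, hU, hV, hxU, hxV, hUV⟩ := t2_separation hne
    have h1 := hcl.frequently (hU.mem_nhds hxU)
    have h2 := hl'.eventually (hV.mem_nhds hxV)
    obtain ⟨n, hn1, hn2⟩ := (h1.and_eventually h2).exists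
    exact Set.disjoint_left.1 hUV hn1 hn2
  rw [this]
  exact hl

/-- measurability of a family of probability measures from integrals of continuous functions -/
theorem measurable_measure_of_integrals {Ω X : Type*} [MeasurableSpace Ω] [MetricSpace X] [MeasurableSpace X]
    [BorelSpace X] (ν : Ω → Measure X) (hν : ∀ ω, IsProbabilityMeasure (ν ω))
    (hm : ∀ F : X → ℝ, Continuous F → (∃ B, ∀ x, |F x| ≤ B) → Measurable fun ω => ∫ x, F x ∂(ν ω)) :
    Measurable ν := by
  refine Measurable.measure_of_isPiSystem_of_isProbabilityMeasure (S := {s | IsClosed s}) ?_ ?_ ?_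
  · rw [BorelSpace.measurable_eq (α := X), borel_eq_generateFrom_isClosed]
  · exact fun s hs t ht _ => IsClosed.inter hs ht
  · intro s hs
    have hpos : ∀ n : ℕ, (0:ℝ) < 1 / ((n:ℝ) + 1) := fun n => by positivity
    refine measurable_of_tendsto_metrizable (f := fun (n : ℕ) ω => ∫⁻ x, (thickenedIndicator (hpos n) s x : ENNReal) ∂(ν ω)) ?_ ?_
    · intro n
      have h1 := hm (fun x => ((thickenedIndicator (hpos n) s x : NNReal) : ℝ)) (by fun_prop) ⟨1, fun x => by
        rw [abs_of_nonneg (NNReal.coe_nonneg _)]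
        exact_mod_cast thickenedIndicator_le_one (hpos n) s x⟩
      have h2 := h1.ennreal_ofReal
      convert h2 using 2 with ω
      rw [ofReal_integral_eq_lintegral_ofReal]
      · simp
      · refine Integrable.of_bound (C := 1) (by fun_prop) (ae_of_all _ fun x => ?_)
        rw [Real.norm_of_nonneg (NNReal.coe_nonneg _)]
        exact_mod_cast thickenedIndicator_le_one (hpos n) s x
      · exact ae_of_all _ fun x => NNReal.coe_nonneg _
    · rw [tendsto_pi_nhds]
      intro ω
      exact tendsto_lintegral_thickenedIndicator_of_isClosed _ hs hpos tendsto_one_div_add_atTop_nhds_zero_nat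

theorem convexComb_eventually {ι : ℕ → Type} [∀ n, Fintype (ι n)] (w : ∀ n, ι n → ℝ) (m : ∀ n, ι n → ℕ)
    (hw0 : ∀ n i, 0 ≤ w n i) (hw1 : ∀ n, ∑ i, w n i = 1) (hm : ∀ n i, n ≤ m n i)
    (I : ℕ → ℝ) (L a : ℝ) (hL : Tendsto (fun n => ∑ i, w n i * I (m n i)) atTop (𝓝 L))
    (ha : ∀ ε > 0, ∀ᶠ k in atTop, a - ε ≤ I k) : a ≤ L := by
  refine le_of_forall_pos_le_add fun ε hε => ?_
  obtain ⟨N, hN⟩ := eventually_atTop.1 (ha ε hε)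
  have : a - ε ≤ L := by
    refine ge_of_tendsto hL (eventually_atTop.2 ⟨N, fun n hn => ?_⟩)
    calc a - ε = ∑ i, w n i * (a - ε) := by rw [← Finset.sum_mul, hw1, one_mul]
      _ ≤ _ := Finset.sum_le_sum fun i _ => 
        mul_le_mul_of_nonneg_left (hN _ (hn.trans (hm n i))) (hw0 n i)
  linarith

theorem kernel_limit {Ω X : Type*} [MeasurableSpace Ω] [MetricSpace X] [ProperSpace X]
    [MeasurableSpace X] [BorelSpace X] (P : Measure Ω) [IsProbabilityMeasure P]
    (κ : ℕ → ProbabilityTheory.Kernel Ω X) (hκ : ∀ n, ProbabilityTheory.IsMarkovKernel (κ n))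
    (Q : Ω → Set X) (hQ : ∀ ω, IsCompact (Q ω)) (hκQ : ∀ n ω, κ n ω (Q ω)ᶜ = 0) :
    ∃ κ' : ProbabilityTheory.Kernel Ω X, ProbabilityTheory.IsMarkovKernel κ' ∧
      ∀ F : Ω → X → ℝ, Measurable (Function.uncurry F) → (∀ ω, Continuous (F ω)) →
        ∀ B : ℝ, (∀ ω x, |F ω x| ≤ B) → ∀ a : ℝ,
        (∀ ε > 0, ∀ᶠ m in atTop, a - ε ≤ ∫ ω, ∫ x, F ω x ∂(κ m ω) ∂P) →
        a ≤ ∫ ω, ∫ x, F ω x ∂(κ' ω) ∂P := by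
  classical
  have : Nonempty Ω := by
    by_contra hne
    rw [not_nonempty_iff] at hne
    have : P Set.univ = 0 := by rw [Set.univ_eq_empty_iff.2 hne]; simp
    simp at this
  obtain ⟨ω0⟩ := this
  have : Nonempty X := by
    by_contra hne
    rw [not_nonempty_iff] at hne
    have : κ 0 ω0 Set.univ = 0 := by rw [Set.univ_eq_empty_iff.2 hne]; simp
    simp at this
  let f : ℕ → C(X, ℝ) := TopologicalSpace.denseSeq C(X, ℝ)
  have hf : DenseRange f := TopologicalSpace.denseRange_denseSeq _
  let G : ℕ → X → ℝ := fun i x => max (-1) (min (f i x) 1)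
  have hGc : ∀ i, Continuous (G i) := fun i => continuous_const.max ((f i).continuous.min continuous_const)
  have hGb : ∀ i x, |G i x| ≤ 1 := fun i x =>
    abs_le.2 ⟨le_max_left _ _, max_le (by norm_num) (min_le_right _ _)⟩
  let c : Measure ℕ := (Measure.count : Measure ℕ).toFinite
  let ρm : Measure (Ω × ℕ) := P.prod c
  let V : ℕ → Ω × ℕ → ℝ := fun n q => ∫ x, G q.2 x ∂(κ n q.1)
  have hVm : ∀ n, Measurable (V n) := by
    intro n
    apply measurable_from_prod_countable_left
    intro i
    have := (hGc i).measurable.stronglyMeasurable.integral_kernel (κ := κ n)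
    exact this.measurable
  have hVb : ∀ n q, |V n q| ≤ 1 := by
    intro n q
    have := norm_integral_le_of_norm_le_const (μ := κ n q.1) (f := G q.2) (C := 1) (ae_of_all _ (hGb q.2))
    simpa using this
  have hVL : ∀ n, MemLp (V n) 2 ρm := fun n =>
    MemLp.of_bound (hVm n).aestronglyMeasurable 1 (ae_of_all _ (hVb n))
  let v : ℕ → Lp ℝ 2 ρm := fun n => (hVL n).toLp
  obtain ⟨D, hD⟩ : ∃ D, ∀ n, ‖v n‖ ≤ D := by
    refine ⟨(ρm.real Set.univ) ^ (2 : ENNReal).toReal⁻¹ * 1, fun n => ?_⟩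
    have h1 := Lp.norm_le_of_ae_bound (f := v n) (C := 1) (by norm_num) (by
      filter_upwards [(hVL n).coeFn_toLp] with q hq
      rw [hq]; exact hVb n q)
    exact h1
  obtain ⟨w, hw, hwc⟩ := komlos_aux v D hD
  obtain ⟨W, hW⟩ := cauchySeq_tendsto_of_complete hwc
  obtain ⟨ns, hns, hae⟩ := (tendstoInMeasure_of_tendsto_Lp hW).exists_seq_tendsto_ae
  have hex : ∀ n, ∃ (ι : Type) (_ : Fintype ι) (u : ι → ℝ) (m : ι → ℕ), (∀ i, 0 ≤ u i) ∧ ∑ i, u i = 1 ∧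
      (∀ i, n ≤ m i) ∧ ∑ i, u i • v (m i) = w (ns n) := by
    intro n
    obtain ⟨ι, hι, u, z, h1, h2, h3, h4⟩ := mem_convexHull_iff_exists_fintype.1 (hw (ns n))
    choose m hm hmz using h3
    refine ⟨ι, hι, u, m, h1, h2, fun i => hns.le_apply.trans (hm i), ?_⟩
    simp only [hmz]; exact h4
  choose ι hι u m hu0 hu1 hm hum using hex
  have hae2 : ∀ᵐ q ∂ρm, ∀ n, (w (ns n) : Ω × ℕ → ℝ) q = ∑ i, u n i * V (m n i) q := by
    rw [ae_all_iff]
    intro n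
    rw [← hum n]
    have h1 : ∀ᵐ q ∂ρm, ∀ i, (v (m n i) : Ω × ℕ → ℝ) q = V (m n i) q := by
      rw [ae_all_iff]; intro i; exact (hVL _).coeFn_toLp
    have h2 : ∀ᵐ q ∂ρm, ∀ i, (u n i • v (m n i) : Lp ℝ 2 ρm) q = u n i * (v (m n i) : Ω × ℕ → ℝ) q := by
      rw [ae_all_iff]; intro i; exact Lp.coeFn_smul _ _
    have h3 := Lp.coeFn_finsetSum (Finset.univ : Finset (ι n)) (fun i => u n i • v (m n i))
    filter_upwards [h1, h2, h3] with q a1 a2 a3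
    rw [a3]
    simp only [Finset.sum_apply]
    exact Finset.sum_congr rfl fun i _ => by rw [a2, a1]
  have hae3 : ∀ᵐ ω ∂P, ∀ i, ∃ l, Tendsto (fun n => ∑ j, u n j * V (m n j) (ω, i)) atTop (𝓝 l) := by
    have h1 : ∀ᵐ q ∂ρm, ∃ l, Tendsto (fun n => ∑ j, u n j * V (m n j) q) atTop (𝓝 l) := by
      filter_upwards [hae, hae2] with q a1 a2
      exact ⟨_, a1.congr fun n => a2 n⟩
    have h2 := Measure.ae_ae_of_ae_prod h1
    filter_upwards [h2] with ω hω
    have h3 : ∀ᵐ i ∂(Measure.count : Measure ℕ), ∃ l, Tendsto (fun n => ∑ j, u n j * V (m n j) (ω, i)) atTop (𝓝 l) := by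
      have := absolutelyContinuous_toFinite (Measure.count : Measure ℕ)
      exact this.ae_le hω
    simpa [Measure.ae_count_iff] using h3
  let K' : ℕ → Ω → Measure X := fun n ω => ∑ j, ENNReal.ofReal (u n j) • κ (m n j) ω
  have hK'p : ∀ n ω, IsProbabilityMeasure (K' n ω) := by
    intro n ω
    constructor
    simp only [K', Measure.coe_finsetSum, Finset.sum_apply, Measure.smul_apply, measure_univ, smul_eq_mul, mul_one]
    rw [← ENNReal.ofReal_sum_of_nonneg (fun i _ => hu0 n i), hu1 n]; simp
  have hK'Q : ∀ n ω, K' n ω (Q ω)ᶜ = 0 := by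
    intro n ω
    simp [K', hκQ]
  have hK'int : ∀ n ω (F : X → ℝ), Continuous F → (∃ B, ∀ x, |F x| ≤ B) →
      ∫ x, F x ∂(K' n ω) = ∑ j, u n j * ∫ x, F x ∂(κ (m n j) ω) := by
    rintro n ω F hF ⟨B, hB⟩
    simp only [K']
    rw [integral_finsetSum_measure]
    · refine Finset.sum_congr rfl fun j _ => ?_
      rw [integral_smul_measure, ENNReal.toReal_ofReal (hu0 n j), smul_eq_mul]
    · intro j _
      refine Integrable.smul_measure ?_ (by simp)
      exact Integrable.of_bound hF.aestronglyMeasurable B (ae_of_all _ hB)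
  obtain ⟨S, hSsub, hSm, hS0⟩ := exists_measurable_superset_of_null (ae_iff.1 hae3)
  have hgood : ∀ ω, ω ∉ S → ∀ i, ∃ l, Tendsto (fun n => ∑ j, u n j * V (m n j) (ω, i)) atTop (𝓝 l) := by
    intro ω hω
    by_contra hcon
    exact hω (hSsub hcon)
  have hlim : ∀ ω, ∃ ν' : Measure X, IsProbabilityMeasure ν' ∧ (ω ∈ S → ν' = κ 0 ω) ∧
      (ω ∉ S → ∀ F : X → ℝ, Continuous F → (∃ B, ∀ x, |F x| ≤ B) →
      Tendsto (fun n => ∑ j, u n j * ∫ x, F x ∂(κ (m n j) ω)) atTop (𝓝 (∫ x, F x ∂ν'))) := by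
    intro ω
    by_cases hω : ω ∈ S
    · exact ⟨κ 0 ω, inferInstance, fun _ => rfl, fun h => absurd hω h⟩
    · obtain ⟨ν', h1, h2⟩ := exists_limit_measure (fun n => K' n ω) (fun n => hK'p n ω) (Q ω) (hQ ω)
        (fun n => hK'Q n ω) f hf (by
          intro i
          obtain ⟨l, hl⟩ := hgood ω hω i
          exact ⟨l, hl.congr fun n => (hK'int n ω (G i) (hGc i) ⟨1, hGb i⟩).symm⟩)
      refine ⟨ν', h1, fun h => absurd h hω, fun _ F hF hB => ?_⟩
      exact (h2 F hF hB).congr fun n => hK'int n ω F hF hB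
  choose ν hνp hνS hνlim using hlim
  have hνm : Measurable ν := by
    apply measurable_measure_of_integrals ν hνp
    intro F hF hB
    refine measurable_of_tendsto_metrizable (f := fun (n : ℕ) ω => if ω ∈ S then ∫ x, F x ∂(κ 0 ω) else
      ∑ j, u n j * ∫ x, F x ∂(κ (m n j) ω)) ?_ ?_
    · intro n
      refine Measurable.ite hSm ?_ ?_
      · exact (hF.measurable.stronglyMeasurable.integral_kernel (κ := κ 0)).measurable
      · refine Finset.measurable_sum _ fun j _ => Measurable.const_mul ?_ _
        exact (hF.measurable.stronglyMeasurable.integral_kernel (κ := κ (m n j))).measurable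
    · rw [tendsto_pi_nhds]
      intro ω
      by_cases hω : ω ∈ S
      · simp only [hω, if_true, hνS ω hω]; exact tendsto_const_nhds
      · simp only [hω, if_false]; exact hνlim ω hω F hF hB
  let κ' : ProbabilityTheory.Kernel Ω X := ⟨ν, hνm⟩
  have hκ' : ProbabilityTheory.IsMarkovKernel κ' := ⟨hνp⟩
  refine ⟨κ', hκ', ?_⟩
  intro F hFm hFc B hB a ha
  have hIm : ∀ n, Measurable fun ω => ∫ x, F ω x ∂(κ n ω) := fun n =>
    (hFm.stronglyMeasurable.integral_kernel_prod_right (κ := κ n)).measurable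
  have hIb : ∀ n ω, |∫ x, F ω x ∂(κ n ω)| ≤ B := by
    intro n ω
    have := norm_integral_le_of_norm_le_const (μ := κ n ω) (f := F ω) (C := B) (ae_of_all _ (hB ω))
    simpa using this
  have hIi : ∀ n, Integrable (fun ω => ∫ x, F ω x ∂(κ n ω)) P := fun n =>
    Integrable.of_bound (hIm n).aestronglyMeasurable B (ae_of_all _ (hIb n))
  refine convexComb_eventually u m hu0 hu1 hm (fun k => ∫ ω, ∫ x, F ω x ∂(κ k ω) ∂P) _ a ?_ ha
  have hDCT := tendsto_integral_of_dominated_convergence (μ := P)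
    (F := fun n ω => ∑ j, u n j * ∫ x, F ω x ∂(κ (m n j) ω)) (f := fun ω => ∫ x, F ω x ∂(κ' ω)) (fun _ => B)
    (fun n => (Finset.measurable_sum _ fun j _ => (hIm _).const_mul _).aestronglyMeasurable)
    (integrable_const _)
    (fun n => ae_of_all _ fun ω => by
      calc ‖∑ j, u n j * ∫ x, F ω x ∂(κ (m n j) ω)‖ ≤ ∑ j, u n j * B := by
            refine norm_sum_le_of_le _ fun j _ => ?_
            rw [norm_mul, Real.norm_of_nonneg (hu0 n j)]
            exact mul_le_mul_of_nonneg_left (hIb _ _) (hu0 n j)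
        _ = B := by rw [← Finset.sum_mul, hu1, one_mul])
    (by
      have : ∀ᵐ ω ∂P, ω ∉ S := by rw [ae_iff]; simpa using hS0
      filter_upwards [this] with ω hω
      exact hνlim ω hω (F ω) (hFc ω) ⟨B, hB ω⟩)
  refine hDCT.congr fun n => ?_
  rw [integral_finsetSum]
  · exact Finset.sum_congr rfl fun j _ => integral_const_mul _ _
  · exact fun j _ => (hIi _).const_mul _

/-- skew product map -/
def skewMap {Ω X : Type*} (θ : Ω → Ω) (Tm : Ω → X → X) (q : Ω × X) : Ω × X := (θ q.1, Tm q.1 q.2)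

theorem skewMap_iterate_fst {Ω X : Type*} (θ : Ω → Ω) (Tm : Ω → X → X) (n : ℕ) (q : Ω × X) :
    ((skewMap θ Tm)^[n] q).1 = θ^[n] q.1 := by
  induction n with
  | zero => rfl
  | succ n ih => rw [Function.iterate_succ_apply', Function.iterate_succ_apply', ← ih]; rfl

theorem carath {Ω X Y : Type*} [MeasurableSpace Ω] [MetricSpace X] [ProperSpace X]
    [MeasurableSpace X] [BorelSpace X] [MetricSpace Y] [MeasurableSpace Y] [BorelSpace Y] (f : Ω → X → Y) (hc : ∀ ω, Continuous (f ω))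
    (hm : ∀ x, Measurable fun ω => f ω x) : Measurable (Function.uncurry f) := by
  have h : Measurable (Function.uncurry (fun x ω => f ω x)) :=
    measurable_uncurry_of_continuous_of_measurable (u := fun x ω => f ω x) hc hm
  exact h.comp measurable_swap

set_option maxHeartbeats 2000000 in
theorem orbit_measure {Ω X : Type*} [MeasurableSpace Ω] [MetricSpace X] [ProperSpace X]
    [MeasurableSpace X] [BorelSpace X] (P : Measure Ω) [IsProbabilityMeasure P]
    (θ θinv : Ω → Ω) (hθ : MeasurePreserving θ P P) (hθim : Measurable θinv)
    (hli : Function.LeftInverse θinv θ) (hri : Function.RightInverse θinv θ)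
    (Tm : Ω → X → X) (hTc : ∀ ω, Continuous (Tm ω)) (hTm : ∀ x, Measurable fun ω => Tm ω x)
    (K : Ω → Set X) (hKc : ∀ ω, IsCompact (K ω)) (hKn : ∀ ω, (K ω).Nonempty)
    (hKm : ∀ x, Measurable fun ω => infDist x (K ω))
    (x : ℕ → Ω → X) (hx : ∀ m, Measurable (x m))
    (hnear : ∀ m ω, ∀ j ≤ m, infDist ((skewMap θ Tm)^[j] (ω, x m ω)).2 (K (θ^[j] ω)) < 1 / ((m : ℝ) + 1)) :
    ∃ μ : Measure (Ω × X), IsProbabilityMeasure μ ∧ μ.map (skewMap θ Tm) = μ ∧ μ.map Prod.fst = P ∧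
      μ {q | q.2 ∈ K q.1} = 1 ∧ 
      ∀ F : Ω → X → ℝ, Measurable (Function.uncurry F) → (∀ ω, Continuous (F ω)) →
        ∀ B : ℝ, (∀ ω x, |F ω x| ≤ B) → ∀ a : ℝ,
        (∀ ε > 0, ∀ᶠ m : ℕ in atTop, a - ε ≤ ((m : ℝ) + 1)⁻¹ * ∑ j ∈ Finset.range (m + 1),
          ∫ ω, Function.uncurry F ((skewMap θ Tm)^[j] (ω, x m ω)) ∂P) →
        a ≤ ∫ q, Function.uncurry F q ∂μ := by
  classical
  have hcar : Measurable (Function.uncurry Tm) := carath Tm hTc hTm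
  have hTh : Measurable (skewMap θ Tm) := (hθ.measurable.comp measurable_fst).prodMk hcar
  have hdm : Measurable (fun q : Ω × X => infDist q.2 (K q.1)) :=
    carath (fun ω x => infDist x (K ω)) (fun ω => continuous_infDist_pt _) hKm
  let Z : ℕ → ℕ → Ω → X := fun m j ω => ((skewMap θ Tm)^[j] (θinv^[j] ω, x m (θinv^[j] ω))).2
  have hθj : ∀ j ω, θ^[j] (θinv^[j] ω) = ω := fun j ω => hri.iterate j ω
  have hθj' : ∀ j ω, θinv^[j] (θ^[j] ω) = ω := fun j ω => hli.iterate j ω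
  have hZeq : ∀ m j ω, (skewMap θ Tm)^[j] (θinv^[j] ω, x m (θinv^[j] ω)) = (ω, Z m j ω) := by
    intro m j ω
    refine Prod.ext ?_ rfl
    rw [skewMap_iterate_fst]; exact hθj j ω
  have hpm : ∀ m j, Measurable (fun ω => (skewMap θ Tm)^[j] (ω, x m ω)) := fun m j =>
    (hTh.iterate j).comp (measurable_id.prodMk (hx m))
  have hZm : ∀ m j, Measurable (Z m j) := fun m j =>
    ((hpm m j).comp (hθim.iterate j)).snd
  have hZnear : ∀ m j ω, j ≤ m → infDist (Z m j ω) (K ω) < 1 / ((m : ℝ) + 1) := by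
    intro m j ω hj
    have := hnear m (θinv^[j] ω) j hj
    rwa [hθj] at this
  let κ : ℕ → ProbabilityTheory.Kernel Ω X := fun m =>
    ⟨fun ω => ((m : ENNReal) + 1)⁻¹ • ∑ j ∈ Finset.range (m + 1), Measure.dirac (Z m j ω), by
      refine Measure.measurable_of_measurable_coe _ fun s hs => ?_
      simp only [Measure.smul_apply, Measure.coe_finsetSum, Finset.sum_apply, smul_eq_mul]
      refine Measurable.const_mul (Finset.measurable_sum _ fun j _ => ?_) _
      exact (Measure.measurable_coe hs).comp (Measure.measurable_dirac.comp (hZm m j))⟩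
  have hκapp : ∀ m ω, κ m ω = ((m : ENNReal) + 1)⁻¹ • ∑ j ∈ Finset.range (m + 1), Measure.dirac (Z m j ω) :=
    fun _ _ => rfl
  have hκp : ∀ m, ProbabilityTheory.IsMarkovKernel (κ m) := by
    intro m
    refine ⟨fun ω => ⟨?_⟩⟩
    rw [hκapp]
    simp only [Measure.smul_apply, Measure.coe_finsetSum, Finset.sum_apply, measure_univ, Finset.sum_const,
      Finset.card_range, smul_eq_mul, nsmul_eq_mul, mul_one]
    push_cast
    exact ENNReal.inv_mul_cancel (by simp) (by finiteness)
  have hκint : ∀ m ω (f : X → ℝ), Continuous f → ∫ y, f y ∂(κ m ω) =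
      ((m : ℝ) + 1)⁻¹ * ∑ j ∈ Finset.range (m + 1), f (Z m j ω) := by
    intro m ω f hf
    rw [hκapp, integral_smul_measure, integral_finsetSum_measure]
    · have h1 : ((m : ENNReal) + 1)⁻¹.toReal = ((m : ℝ) + 1)⁻¹ := by
        rw [ENNReal.toReal_inv, ENNReal.toReal_add (by simp) (by simp)]; simp
      rw [h1, smul_eq_mul]
      congr 1
      refine Finset.sum_congr rfl fun j _ => ?_
      rw [integral_dirac]
    · intro j _
      exact integrable_dirac (by finiteness)
  obtain ⟨κ', hκ', hlim⟩ := kernel_limit P κ hκp (fun ω => cthickening 1 (K ω)) (fun ω => (hKc ω).cthickening) (by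
    intro m ω
    rw [hκapp]
    simp only [Measure.smul_apply, Measure.coe_finsetSum, Finset.sum_apply, smul_eq_mul]
    rw [Finset.sum_eq_zero, mul_zero]
    intro j hj
    rw [Measure.dirac_apply' _ (isClosed_cthickening.measurableSet.compl)]
    simp only [Set.indicator_apply_eq_zero, Set.mem_compl_iff]
    intro hno
    exfalso
    apply hno
    have h1 := hZnear m j ω (by simpa [Nat.lt_succ_iff] using hj)
    have h2 : 1 / ((m : ℝ) + 1) ≤ 1 := by
      rw [div_le_one (by positivity)]; have : (0:ℝ) ≤ m := by positivity
      linarith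
    apply thickening_subset_cthickening
    rw [mem_thickening_iff_infDist_lt (hKn ω)]
    linarith)
  have hInt0 : ∀ F : Ω → X → ℝ, Measurable (Function.uncurry F) → (∀ ω, Continuous (F ω)) →
        ∀ B : ℝ, (∀ ω x, |F ω x| ≤ B) → ∀ m : ℕ, ∫ ω, ∫ y, F ω y ∂(κ m ω) ∂P = 
          ((m : ℝ) + 1)⁻¹ * ∑ j ∈ Finset.range (m + 1),
          ∫ ω, Function.uncurry F ((skewMap θ Tm)^[j] (ω, x m ω)) ∂P := by
    intro F hFm hFc B hB m
    simp_rw [fun ω => hκint m ω (F ω) (hFc ω)]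
    rw [integral_const_mul, integral_finsetSum]
    · congr 1
      refine Finset.sum_congr rfl fun j _ => ?_
      have hmp := hθ.iterate j
      conv_lhs => rw [← hmp.map_eq]
      rw [integral_map hmp.measurable.aemeasurable]
      · refine integral_congr_ae (ae_of_all _ fun ω => ?_)
        show Function.uncurry F (θ^[j] ω, Z m j (θ^[j] ω)) = _
        rw [← hZeq, hθj']
      · exact (hFm.comp (measurable_id.prodMk (hZm m j))).aestronglyMeasurable
    · intro j _
      exact Integrable.of_bound (hFm.comp (measurable_id.prodMk (hZm m j))).aestronglyMeasurable B
        (ae_of_all _ fun ω => hB ω _)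
  have hμint : ∀ F : Ω → X → ℝ, Measurable (Function.uncurry F) → 
        ∀ B : ℝ, (∀ ω x, |F ω x| ≤ B) → ∫ q, Function.uncurry F q ∂(Measure.compProd P κ') = ∫ ω, ∫ y, F ω y ∂(κ' ω) ∂P := by
    intro F hFm B hB
    rw [Measure.integral_compProd]
    · rfl
    · exact Integrable.of_bound hFm.aestronglyMeasurable B (ae_of_all _ fun q => hB q.1 q.2)
  have hmain : ∀ F : Ω → X → ℝ, Measurable (Function.uncurry F) → (∀ ω, Continuous (F ω)) →
        ∀ B : ℝ, (∀ ω x, |F ω x| ≤ B) → ∀ a : ℝ,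
        (∀ ε > 0, ∀ᶠ m : ℕ in atTop, a - ε ≤ ((m : ℝ) + 1)⁻¹ * ∑ j ∈ Finset.range (m + 1),
          ∫ ω, Function.uncurry F ((skewMap θ Tm)^[j] (ω, x m ω)) ∂P) →
        a ≤ ∫ q, Function.uncurry F q ∂(Measure.compProd P κ') := by
    intro F hFm hFc B hB a ha
    rw [hμint F hFm B hB]
    refine hlim F hFm hFc B hB a fun ε hε => ?_
    filter_upwards [ha ε hε] with m hm
    rw [hInt0 F hFm hFc B hB m]; exact hm
  refine ⟨Measure.compProd P κ', inferInstance, ?_, ?_, ?_, hmain⟩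
  · -- invariance
    set μ := Measure.compProd P κ' with hμ
    have hFint : ∀ F : Ω × X → ℝ, Measurable F → (∃ B, ∀ q, |F q| ≤ B) → Integrable F μ := by
      rintro F hF ⟨B, hB⟩
      exact Integrable.of_bound hF.aestronglyMeasurable B (ae_of_all _ hB)
    have hle : ∀ F : Ω → X → ℝ, Measurable (Function.uncurry F) → (∀ ω, Continuous (F ω)) →
        ∀ B : ℝ, (∀ ω x, |F ω x| ≤ B) → ∫ q, Function.uncurry F q ∂μ ≤ ∫ q, Function.uncurry F (skewMap θ Tm q) ∂μ := by
      intro F hFm hFc B hB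
      have hBn : 0 ≤ B := by
        obtain ⟨q⟩ : Nonempty (Ω × X) := (inferInstance : NeZero μ).out |> fun h => by
          by_contra hne
          rw [not_nonempty_iff] at hne
          exact h (Measure.eq_zero_of_isEmpty μ)
        exact (abs_nonneg _).trans (hB q.1 q.2)
      have hFT : Measurable fun q => Function.uncurry F (skewMap θ Tm q) := hFm.comp hTh
      let G : Ω → X → ℝ := fun ω y => F (θ ω) (Tm ω y) - F ω y
      have hGu : Function.uncurry G = fun q => Function.uncurry F (skewMap θ Tm q) - Function.uncurry F q := rfl
      have hGm : Measurable (Function.uncurry G) := by rw [hGu]; exact hFT.sub hFm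
      have := hmain G hGm (fun ω => ((hFc _).comp (hTc ω)).sub (hFc ω)) (B + B)
        (fun ω y => (abs_sub _ _).trans (add_le_add (hB _ _) (hB _ _))) 0 (by
          intro ε hε
          have hlim0 : Tendsto (fun m : ℕ => (2 * B) * (1 / ((m:ℝ) + 1))) atTop (𝓝 0) := by
            simpa using tendsto_one_div_add_atTop_nhds_zero_nat.const_mul (2 * B)
          filter_upwards [hlim0.eventually (gt_mem_nhds hε)] with m hm
          have hi : ∀ j, Integrable (fun ω => Function.uncurry F ((skewMap θ Tm)^[j] (ω, x m ω))) P := fun j =>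
            Integrable.of_bound (hFm.comp (hpm m j)).aestronglyMeasurable B (ae_of_all _ fun ω => hB _ _)
          have htel : ∑ j ∈ Finset.range (m + 1), ∫ ω, Function.uncurry G ((skewMap θ Tm)^[j] (ω, x m ω)) ∂P
              = ∫ ω, Function.uncurry F ((skewMap θ Tm)^[m+1] (ω, x m ω)) ∂P - 
                ∫ ω, Function.uncurry F ((skewMap θ Tm)^[0] (ω, x m ω)) ∂P := by
            rw [← Finset.sum_range_sub (fun j => ∫ ω, Function.uncurry F ((skewMap θ Tm)^[j] (ω, x m ω)) ∂P)]
            refine Finset.sum_congr rfl fun j _ => ?_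
            rw [← integral_sub (hi _) (hi _)]
            refine integral_congr_ae (ae_of_all _ fun ω => ?_)
            simp only [hGu, Function.iterate_succ_apply']
          rw [htel]
          have hb : ∀ j, |∫ ω, Function.uncurry F ((skewMap θ Tm)^[j] (ω, x m ω)) ∂P| ≤ B := by
            intro j
            have := norm_integral_le_of_norm_le_const (μ := P)
              (f := fun ω => Function.uncurry F ((skewMap θ Tm)^[j] (ω, x m ω))) (C := B) (ae_of_all _ fun ω => hB _ _)
            simpa using this
          have h1 := abs_le.1 (hb (m+1))
          have h2 := abs_le.1 (hb 0)
          have h3 : (0:ℝ) < ((m:ℝ)+1)⁻¹ := by positivity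
          rw [one_div] at hm
          have h4 : ((m:ℝ)+1)⁻¹ * (-(2*B)) ≤ ((m:ℝ)+1)⁻¹ * (∫ ω, Function.uncurry F ((skewMap θ Tm)^[m+1] (ω, x m ω)) ∂P - 
                ∫ ω, Function.uncurry F ((skewMap θ Tm)^[0] (ω, x m ω)) ∂P) :=
            mul_le_mul_of_nonneg_left (by linarith) h3.le
          nlinarith)
      rw [hGu, integral_sub (hFint _ hFT ⟨B, fun q => hB _ _⟩) (hFint _ hFm ⟨B, fun q => hB _ _⟩)] at this
      linarith
    have heq : ∀ F : Ω → X → ℝ, Measurable (Function.uncurry F) → (∀ ω, Continuous (F ω)) →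
        ∀ B : ℝ, (∀ ω x, |F ω x| ≤ B) → ∫ q, Function.uncurry F (skewMap θ Tm q) ∂μ = ∫ q, Function.uncurry F q ∂μ := by
      intro F hFm hFc B hB
      refine le_antisymm ?_ (hle F hFm hFc B hB)
      have hu : Function.uncurry (fun ω y => - F ω y) = fun q => - Function.uncurry F q := rfl
      have := hle (fun ω y => - F ω y) (by rw [hu]; exact hFm.neg) (fun ω => (hFc ω).neg) B (fun ω y => by
        rw [abs_neg]; exact hB ω y)
      simp only [hu, integral_neg] at this
      linarith
    have : IsProbabilityMeasure (μ.map (skewMap θ Tm)) := Measure.isProbabilityMeasure_map hTh.aemeasurable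
    refine Measure.ext_prod fun {s t} hs ht => ?_
    have hm : ∀ ρ : Measure (Ω × X), ∀ t, MeasurableSet t → ((ρ.restrict (s ×ˢ Set.univ)).map Prod.snd) t = ρ (s ×ˢ t) := by
      intro ρ t ht
      rw [Measure.map_apply measurable_snd ht, Measure.restrict_apply (measurable_snd ht)]
      congr 1
      ext q; simp [and_comm]
    rw [← hm _ t ht, ← hm _ t ht]
    congr 1
    apply ext_of_forall_integral_eq_of_IsFiniteMeasure
    intro f
    have hcomp : ∀ ρ : Measure (Ω × X), ∫ y, f y ∂((ρ.restrict (s ×ˢ Set.univ)).map Prod.snd) = 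
        ∫ q, Function.uncurry (fun ω y => s.indicator (fun _ => f y) ω) q ∂ρ := by
      intro ρ
      rw [integral_map measurable_snd.aemeasurable f.continuous.aestronglyMeasurable,
        ← integral_indicator (hs.prod MeasurableSet.univ)]
      refine integral_congr_ae (ae_of_all _ fun q => ?_)
      by_cases hq : q.1 ∈ s <;> simp [Set.indicator, hq, Function.uncurry]
    rw [hcomp, hcomp]
    have hum : Measurable (Function.uncurry (fun ω y => s.indicator (fun _ => f y) ω)) := by
      have : (Function.uncurry (fun ω y => s.indicator (fun _ => f y) ω)) = 
          (s ×ˢ (Set.univ : Set X)).indicator (fun q => f q.2) := by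
        ext q; by_cases hq : q.1 ∈ s <;> simp [Set.indicator, hq, Function.uncurry]
      rw [this]
      exact (f.continuous.measurable.comp measurable_snd).indicator (hs.prod MeasurableSet.univ)
    rw [integral_map hTh.aemeasurable hum.aestronglyMeasurable]
    refine heq _ hum (fun ω => ?_) ‖f‖ (fun ω y => ?_)
    · by_cases hω : ω ∈ s <;> simp [Set.indicator, hω]
      · exact f.continuous
      · exact continuous_const
    · by_cases hω : ω ∈ s <;> simp [Set.indicator, hω]
      exact f.norm_coe_le_norm y
  · rw [← Measure.fst]; exact Measure.fst_compProd _ _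
  · -- support
    have hKset : {q : Ω × X | q.2 ∈ K q.1} = {q | infDist q.2 (K q.1) = 0} := by
      ext q
      exact (hKc q.1).isClosed.mem_iff_infDist_zero (hKn q.1)
    let F : Ω → X → ℝ := fun ω y => - min (infDist y (K ω)) 1
    have hFu : Function.uncurry F = fun q => - min (infDist q.2 (K q.1)) 1 := rfl
    have hFm : Measurable (Function.uncurry F) := by rw [hFu]; exact (hdm.min measurable_const).neg
    have hF0 : ∀ q : Ω × X, 0 ≤ min (infDist q.2 (K q.1)) 1 := fun q => le_min infDist_nonneg zero_le_one
    have hFb : ∀ ω y, |F ω y| ≤ 1 := fun ω y => by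
      show |- min (infDist y (K ω)) 1| ≤ 1
      rw [abs_neg, abs_of_nonneg (hF0 (ω, y))]; exact min_le_right _ _
    have hm := hmain F hFm (fun ω => ((continuous_infDist_pt _).min continuous_const).neg) 1 hFb 0 (by
      intro ε hε
      filter_upwards [tendsto_one_div_add_atTop_nhds_zero_nat.eventually (gt_mem_nhds hε)] with m hm
      have hj : ∀ j ∈ Finset.range (m+1), -ε ≤ ∫ ω, Function.uncurry F ((skewMap θ Tm)^[j] (ω, x m ω)) ∂P := by
        intro j hj
        have : ∫ ω, (-ε) ∂P ≤ ∫ ω, Function.uncurry F ((skewMap θ Tm)^[j] (ω, x m ω)) ∂P := by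
          refine integral_mono (integrable_const _) (Integrable.of_bound (hFm.comp (hpm m j)).aestronglyMeasurable 1
            (ae_of_all _ fun ω => hFb _ _)) fun ω => ?_
          have := hnear m ω j (by simpa [Nat.lt_succ_iff] using hj)
          simp only [hFu, skewMap_iterate_fst]
          have h2 := min_le_left (infDist ((skewMap θ Tm)^[j] (ω, x m ω)).2 (K (θ^[j] ω))) 1
          linarith
        simpa using this
      have := Finset.card_nsmul_le_sum _ _ _ hj
      rw [Finset.card_range, nsmul_eq_mul] at this
      have h3 : (0:ℝ) < ((m:ℝ)+1) := by positivity
      rw [inv_mul_eq_div, le_div_iff₀ h3]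
      push_cast at this
      linarith)
    rw [hFu, integral_neg] at hm
    have hI : Integrable (fun q : Ω × X => min (infDist q.2 (K q.1)) 1) (Measure.compProd P κ') :=
      Integrable.of_bound (hdm.min measurable_const).aestronglyMeasurable 1 (ae_of_all _ fun q => by
        rw [Real.norm_of_nonneg (hF0 q)]; exact min_le_right _ _)
    have h0 : ∫ q : Ω × X, min (infDist q.2 (K q.1)) 1 ∂(Measure.compProd P κ') = 0 :=
      le_antisymm (by linarith) (integral_nonneg hF0)
    rw [integral_eq_zero_iff_of_nonneg hF0 hI] at h0
    have hm1 : MeasurableSet {q : Ω × X | infDist q.2 (K q.1) = 0} := hdm (measurableSet_singleton 0)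
    rw [hKset, ← mem_ae_iff_prob_eq_one hm1]
    filter_upwards [h0] with q hq
    have hq' : min (infDist q.2 (K q.1)) 1 = 0 := hq
    show infDist q.2 (K q.1) = 0
    rcases min_choice (infDist q.2 (K q.1)) 1 with h | h
    · rw [← h]; exact hq'
    · rw [h] at hq'; norm_num at hq'

theorem sel {Ω X : Type*} [MeasurableSpace Ω] [MetricSpace X] [ProperSpace X]
    [MeasurableSpace X] [BorelSpace X] (P : Measure Ω) [IsProbabilityMeasure P]
    (K : Ω → Set X) (hKc : ∀ ω, IsCompact (K ω)) (hKn : ∀ ω, (K ω).Nonempty)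
    (hKm : ∀ x, Measurable fun ω => infDist x (K ω))
    (f : Ω → X → ℝ) (hfc : ∀ ω, Continuous (f ω)) (hfm : ∀ x, Measurable fun ω => f ω x)
    (A B : ℝ) (hA : ∀ ω x, A ≤ f ω x) (hB : ∀ ω x, f ω x ≤ B) (ρ : ℝ) (hρ : 0 < ρ)
    (hyp : ∀ a : Ω → ℝ, Measurable a → (∀ ω, A ≤ a ω) → (∀ ω, a ω ≤ B) → ∀ r > 0, r ≤ ρ →
      (∀ ω x, infDist x (K ω) < r → f ω x ≤ a ω) → 0 ≤ ∫ ω, a ω ∂P)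
    (U : Ω → Set X) (hUo : ∀ ω, IsOpen (U ω)) (hUK : ∀ ω, K ω ⊆ U ω)
    (hUm : ∀ x, MeasurableSet {ω | x ∈ U ω}) :
    ∃ (x : Ω → X) (e : Ω → ℝ), Measurable x ∧ Integrable e P ∧ 0 ≤ ∫ ω, e ω ∂P ∧
      ∀ ω, x ω ∈ U ω ∧ e ω - 1 < f ω (x ω) := by
  classical
  have : Nonempty Ω := by
    by_contra hne
    rw [not_nonempty_iff] at hne
    have : P Set.univ = 0 := by rw [Set.univ_eq_empty_iff.2 hne]; simp
    simp at this
  obtain ⟨ω0⟩ := this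
  have : Nonempty X := (hKn ω0).to_type
  let q : ℕ → X := TopologicalSpace.denseSeq X
  have hq : DenseRange q := TopologicalSpace.denseRange_denseSeq _
  let t : ℕ → ℕ → Ω → ℝ := fun m i ω => if infDist (q i) (K ω) < 1 / ((m : ℝ) + 1) then f ω (q i) else A
  have htm : ∀ m i, Measurable (t m i) := fun m i =>
    Measurable.ite (measurableSet_lt (hKm _) measurable_const) (hfm _) measurable_const
  have hAB : A ≤ B := (hA ω0 (q 0)).trans (hB _ _)
  have htA : ∀ m i ω, A ≤ t m i ω := by
    intro m i ω; simp only [t]; split_ifs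
    · exact hA _ _
    · exact le_rfl
  have htB : ∀ m i ω, t m i ω ≤ B := by
    intro m i ω; simp only [t]; split_ifs
    · exact hB _ _
    · exact hAB
  have hbdd : ∀ m ω, BddAbove (Set.range fun i => t m i ω) := by
    intro m ω; refine ⟨B, ?_⟩; rintro _ ⟨i, rfl⟩; exact htB _ _ _
  let a : ℕ → Ω → ℝ := fun m ω => ⨆ i, t m i ω
  have ham : ∀ m, Measurable (a m) := fun m => Measurable.iSup (htm m)
  have haA : ∀ m ω, A ≤ a m ω := fun m ω => (htA m 0 ω).trans (le_ciSup (hbdd m ω) 0)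
  have haB : ∀ m ω, a m ω ≤ B := fun m ω => ciSup_le fun i => htB _ _ _
  have hpos : ∀ m : ℕ, (0:ℝ) < 1 / ((m : ℝ) + 1) := fun m => by positivity
  have hO : ∀ (m : ℕ) ω, IsOpen {x | infDist x (K ω) < 1 / ((m : ℝ) + 1)} := fun m ω =>
    isOpen_lt (continuous_infDist_pt _) continuous_const
  have hfa : ∀ (m : ℕ) ω x, infDist x (K ω) < 1 / ((m : ℝ) + 1) → f ω x ≤ a m ω := by
    intro m ω x hx
    by_contra hlt
    push Not at hlt
    have hO2 : IsOpen ({x | infDist x (K ω) < 1 / ((m : ℝ) + 1)} ∩ {x | a m ω < f ω x}) :=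
      (hO m ω).inter (isOpen_lt continuous_const (hfc ω))
    obtain ⟨i, hi1, hi2⟩ := hq.exists_mem_open hO2 ⟨x, hx, hlt⟩
    have h1 := le_ciSup (hbdd m ω) i
    have h2 : t m i ω = f ω (q i) := if_pos hi1
    rw [h2] at h1
    exact absurd hi2 (not_lt.2 h1)
  have hanti : ∀ ω, Antitone fun m => a m ω := by
    intro ω m n hmn
    refine ciSup_le fun i => ?_
    by_cases hi : infDist (q i) (K ω) < 1 / ((n : ℝ) + 1)
    · have h2 : t n i ω = f ω (q i) := if_pos hi
      rw [h2]
      refine hfa m ω _ (hi.trans_le ?_)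
      exact one_div_le_one_div_of_le (by positivity) (by gcongr)
    · have h2 : t n i ω = A := if_neg hi
      rw [h2]; exact haA _ _
  have hpick : ∀ (m : ℕ) ω c, c < a m ω → ∃ i, infDist (q i) (K ω) < 1 / ((m : ℝ) + 1) ∧ c < f ω (q i) := by
    intro m ω c hc
    obtain ⟨i, hi⟩ := exists_lt_of_lt_ciSup hc
    by_cases hi' : infDist (q i) (K ω) < 1 / ((m : ℝ) + 1)
    · have h2 : t m i ω = f ω (q i) := if_pos hi'
      exact ⟨i, hi', h2 ▸ hi⟩
    · have h2 : t m i ω = A := if_neg hi'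
      rw [h2] at hi
      obtain ⟨y, hy⟩ := hKn ω
      obtain ⟨i', hi1⟩ := hq.exists_mem_open (hO m ω) ⟨y, by
        show infDist y (K ω) < _
        rw [infDist_zero_of_mem hy]; exact hpos m⟩
      exact ⟨i', hi1, hi.trans_le (hA _ _)⟩
  have hbb : ∀ ω, BddBelow (Set.range fun m => a m ω) := by
    intro ω; refine ⟨A, ?_⟩; rintro _ ⟨i, rfl⟩; exact haA _ _
  let e : Ω → ℝ := fun ω => ⨅ m, a m ω
  have hem : Measurable e := Measurable.iInf ham
  have heA : ∀ ω, A ≤ e ω := fun ω => le_ciInf fun m => haA _ _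
  have hea : ∀ m ω, e ω ≤ a m ω := fun m ω => ciInf_le (hbb ω) m
  have habs : ∀ y, A ≤ y → y ≤ B → ‖y‖ ≤ max |A| |B| := fun y h1 h2 => abs_le_max_abs_abs h1 h2
  have hei : Integrable e P := Integrable.of_bound hem.aestronglyMeasurable (max |A| |B|)
    (ae_of_all _ fun ω => habs _ (heA ω) ((hea 0 ω).trans (haB 0 ω)))
  have htend : Tendsto (fun m => ∫ ω, a m ω ∂P) atTop (𝓝 (∫ ω, e ω ∂P)) := by
    refine tendsto_integral_of_dominated_convergence (fun _ => max |A| |B|)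
      (fun m => (ham m).aestronglyMeasurable) (integrable_const _)
      (fun m => ae_of_all _ fun ω => habs _ (haA m ω) (haB m ω)) (ae_of_all _ fun ω => ?_)
    exact tendsto_atTop_ciInf (hanti ω) (hbb ω)
  have he0 : 0 ≤ ∫ ω, e ω ∂P := by
    refine ge_of_tendsto htend ?_
    filter_upwards [tendsto_one_div_add_atTop_nhds_zero_nat.eventually (gt_mem_nhds hρ)] with m hm
    exact hyp (a m) (ham m) (haA m) (haB m) _ (hpos m) hm.le (hfa m)
  have hex : ∀ ω, ∃ i, q i ∈ U ω ∧ e ω - 1 < f ω (q i) := by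
    intro ω
    obtain ⟨δ, hδ, hδU⟩ := (hKc ω).exists_thickening_subset_open (hUo ω) (hUK ω)
    obtain ⟨m, hm⟩ := exists_nat_one_div_lt hδ
    obtain ⟨i, hi1, hi2⟩ := hpick m ω (e ω - 1) (by linarith [hea m ω])
    refine ⟨i, hδU ?_, hi2⟩
    rw [mem_thickening_iff_infDist_lt (hKn ω)]
    exact hi1.trans hm
  refine ⟨fun ω => q (Nat.find (hex ω)), e, ?_, hei, he0, fun ω => Nat.find_spec (hex ω)⟩
  have : Measurable (fun ω => Nat.find (hex ω)) := by
    refine measurable_find hex fun i => ?_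
    exact (hUm (q i)).inter (measurableSet_lt (hem.sub_const 1) (hfm (q i)))
  exact (measurable_from_nat (f := q)).comp this

theorem subadd_sum (u : ℕ → ℕ → ℝ) (k L : ℕ) (C A : ℝ) (hkL : k ≤ L)
    (h1 : ∀ j l1 l2, u j (l1 + l2) ≤ u j l1 + u (j + l1) l2)
    (hub : ∀ j < L, ∀ l ≤ k, u j l ≤ C) (hlb : ∀ j, -A ≤ u j k) :
    k * u 0 L ≤ ∑ j ∈ Finset.range L, u j k + (2 * k * C + k * A) := by
  let w : ℕ → ℝ := fun i => u i (L - i)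
  have hq : ∀ q, q + k ≤ L → ∑ j ∈ Finset.range k, w j ≤ ∑ i ∈ Finset.range q, u i k +
      ∑ j ∈ Finset.range k, w (q + j) := by
    intro q
    induction q with
    | zero => intro _; simp
    | succ q ih =>
      intro hqL
      have h2 := ih (by omega)
      have h3 : w q ≤ u q k + w (q + k) := by
        have := h1 q k (L - (q + k))
        rwa [show k + (L - (q + k)) = L - q by omega] at this
      rw [Finset.sum_range_succ]
      have h4 : ∑ j ∈ Finset.range k, w (q + 1 + j) + w q = ∑ j ∈ Finset.range k, w (q + j) + w (q + k) := by
        rw [← Finset.sum_range_succ (fun j => w (q + j)), Finset.sum_range_succ' (fun j => w (q + j))]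
        simp only [add_zero, add_assoc, add_comm 1]
      linarith
  have h2 := hq (L - k) (by omega)
  have h3 : ∑ j ∈ Finset.range k, w (L - k + j) ≤ k * C := by
    have := Finset.sum_le_card_nsmul (Finset.range k) (fun j => w (L - k + j)) C (by
      intro j hj
      have hj := Finset.mem_range.1 hj
      exact hub _ (by omega) _ (by omega))
    simpa using this
  have h4 : ∑ i ∈ Finset.range (L - k), u i k ≤ ∑ i ∈ Finset.range L, u i k + k * A := by
    have h5 : ∑ i ∈ Finset.range L, u i k = ∑ i ∈ Finset.range (L - k), u i k + ∑ j ∈ Finset.range k, u (L - k + j) k := by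
      conv_lhs => rw [show L = (L - k) + k by omega]
      rw [Finset.sum_range_add]
    have h6 := Finset.card_nsmul_le_sum (Finset.range k) (fun j => u (L - k + j) k) (-A) (fun j _ => hlb _)
    simp at h6
    linarith
  have h5 : k * u 0 L ≤ k * C + ∑ j ∈ Finset.range k, w j := by
    have := Finset.card_nsmul_le_sum (Finset.range k) w (u 0 L - C) (by
      intro j hj
      have hj := Finset.mem_range.1 hj
      have h6 := h1 0 j (L - j)
      rw [show j + (L - j) = L by omega, zero_add] at h6
      have h7 := hub 0 (by omega) j (by omega)
      show _ ≤ u j (L - j)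
      linarith)
    simp at this
    linarith
  linarith

theorem log_limit {α : Type*} [MeasurableSpace α] (μ : Measure α) [IsProbabilityMeasure μ] (N : α → ℝ)
    (hNm : Measurable N) (hN0 : ∀ x, 0 ≤ N x) (C : ℝ) (hC : 0 ≤ C) (k : ℝ) (hk : 1 ≤ k)
    (hNC : ∀ᵐ x ∂μ, N x ≤ Real.exp C)
    (hF : ∀ M : ℕ, 0 ≤ ∫ x, min (Real.log (max (N x) (Real.exp (-(k * M))))) C ∂μ) :
    0 ≤ ∫ x, Real.log (N x) ∂μ := by
  by_cases hInt0 : Integrable (fun x => Real.log (N x)) μ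
  swap
  · rw [integral_undef hInt0]
  have hZm : MeasurableSet {x | N x = 0} := hNm (measurableSet_singleton 0)
  have hFm : ∀ M : ℕ, Measurable fun x => min (Real.log (max (N x) (Real.exp (-(k * M))))) C := fun M =>
    (Real.measurable_log.comp (hNm.max measurable_const)).min measurable_const
  have hlow : ∀ (M : ℕ) x, -(k * M) ≤ Real.log (max (N x) (Real.exp (-(k * M)))) := by
    intro M x
    rw [Real.le_log_iff_exp_le (lt_max_of_lt_right (Real.exp_pos _))]
    exact le_max_right _ _
  have hkM : ∀ M : ℕ, 0 ≤ k * M := fun M => by positivity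
  have hFI : ∀ M : ℕ, Integrable (fun x => min (Real.log (max (N x) (Real.exp (-(k * M))))) C) μ := by
    intro M
    refine Integrable.of_bound (hFm M).aestronglyMeasurable (max (k * M) C) (ae_of_all _ fun x => ?_)
    rw [Real.norm_eq_abs, abs_le]
    constructor
    · refine le_min ?_ ?_
      · linarith [hlow M x, le_max_left (k * M) C]
      · linarith [le_max_right (k * M) C]
    · exact (min_le_right _ _).trans (le_max_right _ _)
  have hZ : μ.real {x | N x = 0} = 0 := by
    by_contra hne
    have hpos : 0 < μ.real {x | N x = 0} := lt_of_le_of_ne measureReal_nonneg (Ne.symm hne)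
    obtain ⟨M, hM⟩ := exists_nat_gt (C / μ.real {x | N x = 0})
    rw [div_lt_iff₀ hpos] at hM
    have h1 : ∫ x, min (Real.log (max (N x) (Real.exp (-(k * M))))) C ∂μ ≤
        ∫ x, (C + {x | N x = 0}.indicator (fun _ => -(k * M)) x) ∂μ := by
      refine integral_mono (hFI M) ((integrable_const _).add ((integrable_const _).indicator hZm)) fun x => ?_
      by_cases hx : N x = 0
      · have : x ∈ {x | N x = 0} := hx
        simp only [Set.indicator_of_mem this, hx]
        rw [max_eq_right (Real.exp_pos _).le, Real.log_exp]
        exact (min_le_left _ _).trans (by linarith)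
      · have : x ∉ {x | N x = 0} := hx
        simp only [Set.indicator_of_notMem this, add_zero]
        exact min_le_right _ _
    rw [integral_add (integrable_const _) ((integrable_const _).indicator hZm), integral_indicator_const _ hZm] at h1
    simp at h1
    have h2 := hF M
    have h3 : (M:ℝ) * μ.real {x | N x = 0} ≤ k * (M * μ.real {x | N x = 0}) :=
      le_mul_of_one_le_left (by positivity) hk
    nlinarith
  have hZ' : ∀ᵐ x ∂μ, N x ≠ 0 := by
    rw [ae_iff]; simp only [not_not]
    exact (measureReal_eq_zero_iff).1 hZ
  have htend : Tendsto (fun M : ℕ => ∫ x, min (Real.log (max (N x) (Real.exp (-(k * M))))) C ∂μ) atTop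
      (𝓝 (∫ x, Real.log (N x) ∂μ)) := by
    refine tendsto_integral_of_dominated_convergence (fun x => |Real.log (N x)|)
      (fun M => (hFm M).aestronglyMeasurable) hInt0.abs ?_ ?_
    · intro M
      filter_upwards [hZ', hNC] with x hx hxC
      have hx0 : 0 < N x := lt_of_le_of_ne (hN0 x) (Ne.symm hx)
      have h1 : Real.log (N x) ≤ C := (Real.log_le_iff_le_exp hx0).2 hxC
      have h2 : Real.log (max (N x) (Real.exp (-(k * M)))) = max (Real.log (N x)) (-(k * M)) := by
        rcases le_total (N x) (Real.exp (-(k * M))) with h | h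
        · rw [max_eq_right h, Real.log_exp, max_eq_right]
          exact (Real.log_le_iff_le_exp hx0).2 h
        · rw [max_eq_left h, max_eq_left]
          exact (Real.le_log_iff_exp_le hx0).2 h
      rw [h2, Real.norm_eq_abs, abs_le]
      have h3 := hkM M
      constructor
      · refine le_min ((neg_abs_le _).trans (le_max_left _ _)) ?_
        linarith [abs_nonneg (Real.log (N x))]
      · refine (min_le_left _ _).trans (max_le (le_abs_self _) ?_)
        linarith [abs_nonneg (Real.log (N x))]
    · filter_upwards [hZ', hNC] with x hx hxC
      have hx0 : 0 < N x := lt_of_le_of_ne (hN0 x) (Ne.symm hx)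
      have h1 : Real.log (N x) ≤ C := (Real.log_le_iff_le_exp hx0).2 hxC
      refine tendsto_const_nhds.congr' ?_
      obtain ⟨M0, hM0⟩ := exists_nat_gt (-Real.log (N x))
      filter_upwards [eventually_ge_atTop M0] with M hM
      have h3 : (M0:ℝ) ≤ M := by exact_mod_cast hM
      have h4 : (M:ℝ) ≤ k * M := le_mul_of_one_le_left (by positivity) hk
      have h5 : Real.exp (-(k * M)) ≤ N x := by
        rw [← Real.le_log_iff_exp_le hx0]; linarith
      rw [max_eq_left h5, min_eq_left h1]
  exact ge_of_tendsto' htend hF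

theorem coreA {Ω X : Type*} [MeasurableSpace Ω] [MetricSpace X] [ProperSpace X]
    [MeasurableSpace X] [BorelSpace X] (P : Measure Ω) [IsProbabilityMeasure P]
    (θ θinv : Ω → Ω) (hθ : MeasurePreserving θ P P) (hθim : Measurable θinv)
    (hli : Function.LeftInverse θinv θ) (hri : Function.RightInverse θinv θ)
    (Tm : Ω → X → X) (hTc : ∀ ω, Continuous (Tm ω)) (hTm : ∀ x, Measurable fun ω => Tm ω x)
    (K : Ω → Set X) (hKc : ∀ ω, IsCompact (K ω)) (hKn : ∀ ω, (K ω).Nonempty)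
    (hKm : ∀ x, Measurable fun ω => infDist x (K ω))
    (hKinv : ∀ ω, Set.MapsTo (Tm ω) (K ω) (K (θ ω)))
    (N : ℕ → Ω → X → ℝ) (hN0 : ∀ k ω x, 0 ≤ N k ω x) (hNc : ∀ k ω, Continuous (N k ω))
    (hNm : ∀ k x, Measurable fun ω => N k ω x)
    (hNsub : ∀ m n ω x, N (m + n) ω x ≤
      N n ((skewMap θ Tm)^[m] (ω, x)).1 ((skewMap θ Tm)^[m] (ω, x)).2 * N m ω x)
    (hNb : ∀ k, ∃ r > 0, ∃ C, ∀ ω x, infDist x (K ω) < r → N k ω x ≤ Real.exp C) :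
    (∃ (k : ℕ) (r : ℝ) (a : Ω → ℝ), 0 < k ∧ 0 < r ∧ Measurable a ∧ (∃ B, ∀ ω, |a ω| ≤ B) ∧ ∫ ω, a ω ∂P < 0 ∧
      ∀ ω x, infDist x (K ω) < r → N k ω x ≤ Real.exp (a ω)) ∨
    (∃ μ : Measure (Ω × X), IsProbabilityMeasure μ ∧ μ.map (skewMap θ Tm) = μ ∧ μ.map Prod.fst = P ∧
      μ {q | q.2 ∈ K q.1} = 1 ∧ ∀ k, 0 ≤ ∫ q, Real.log (N (k + 1) q.1 q.2) ∂μ) := by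
  by_cases hcase : (∃ (k : ℕ) (r : ℝ) (a : Ω → ℝ), 0 < k ∧ 0 < r ∧ Measurable a ∧ (∃ B, ∀ ω, |a ω| ≤ B) ∧ ∫ ω, a ω ∂P < 0 ∧
      ∀ ω x, infDist x (K ω) < r → N k ω x ≤ Real.exp (a ω))
  · exact Or.inl hcase
  right
  have hNb' : ∀ k, ∃ r > 0, ∃ C, 0 ≤ C ∧ ∀ ω x, infDist x (K ω) < r → N k ω x ≤ Real.exp C := by
    intro k
    obtain ⟨r, hr, C, hC⟩ := hNb k
    exact ⟨r, hr, max C 0, le_max_right _ _, fun ω x hx => (hC ω x hx).trans (Real.exp_le_exp.2 (le_max_left _ _))⟩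
  choose r hr C hC0 hC using hNb'
  have hcar : Measurable (Function.uncurry Tm) := carath Tm hTc hTm
  have hTh : Measurable (skewMap θ Tm) := (hθ.measurable.comp measurable_fst).prodMk hcar
  have hNj : ∀ k, Measurable (Function.uncurry (N k)) := fun k => carath (N k) (hNc k) (hNm k)
  have hdm : Measurable (fun q : Ω × X => infDist q.2 (K q.1)) :=
    carath (fun ω x => infDist x (K ω)) (fun ω => continuous_infDist_pt _) hKm
  let b : ℕ → ℕ → Ω → X → ℝ := fun k M ω x => Real.log (max (N k ω x) (Real.exp (-((k:ℝ) * M))))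
  let F : ℕ → ℕ → Ω → X → ℝ := fun k M ω x => min (b k M ω x) (C k)
  have hmpos : ∀ k M ω x, 0 < max (N k ω x) (Real.exp (-((k:ℝ) * M))) := fun k M ω x =>
    lt_max_of_lt_right (Real.exp_pos _)
  have hbc : ∀ k M ω, Continuous (b k M ω) := fun k M ω =>
    Continuous.log ((hNc k ω).max continuous_const) fun x => (hmpos k M ω x).ne'
  have hFc : ∀ k M ω, Continuous (F k M ω) := fun k M ω => (hbc k M ω).min continuous_const
  have hFj : ∀ k M, Measurable (Function.uncurry (F k M)) := fun k M =>
    (Real.measurable_log.comp ((hNj k).max measurable_const)).min measurable_const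
  have hFm : ∀ k M x, Measurable fun ω => F k M ω x := fun k M x =>
    (Real.measurable_log.comp ((hNm k x).max measurable_const)).min measurable_const
  have hblow : ∀ (k M : ℕ) ω x, -((k:ℝ) * M) ≤ b k M ω x := by
    intro k M ω x
    show _ ≤ Real.log _
    rw [Real.le_log_iff_exp_le (hmpos k M ω x)]
    exact le_max_right _ _
  have hkM : ∀ k M : ℕ, (0:ℝ) ≤ (k:ℝ) * M := fun k M => by positivity
  have hFlow : ∀ (k M : ℕ) ω x, -((k:ℝ) * M) ≤ F k M ω x := fun k M ω x =>
    le_min (hblow k M ω x) (by linarith [hkM k M, hC0 k])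
  have hFup : ∀ k M ω x, F k M ω x ≤ C k := fun k M ω x => min_le_right _ _
  have hbC : ∀ k M ω x, infDist x (K ω) < r k → b k M ω x ≤ C k := by
    intro k M ω x hx
    show Real.log _ ≤ _
    rw [Real.log_le_iff_le_exp (hmpos k M ω x)]
    exact max_le (hC k ω x hx) (Real.exp_le_exp.2 (by linarith [hkM k M, hC0 k]))
  have hFb : ∀ k M ω x, infDist x (K ω) < r k → F k M ω x = b k M ω x := fun k M ω x hx =>
    min_eq_left (hbC k M ω x hx)
  have hNb2 : ∀ k M ω x, N k ω x ≤ Real.exp (b k M ω x) := by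
    intro k M ω x
    show _ ≤ Real.exp (Real.log _)
    rw [Real.exp_log (hmpos k M ω x)]; exact le_max_left _ _
  have hbsub : ∀ m n M ω x, b (m + n) M ω x ≤ b m M ω x +
      b n M ((skewMap θ Tm)^[m] (ω, x)).1 ((skewMap θ Tm)^[m] (ω, x)).2 := by
    intro m n M ω x
    show Real.log _ ≤ Real.log _ + Real.log _
    rw [← Real.log_mul (hmpos _ _ _ _).ne' (hmpos _ _ _ _).ne']
    apply Real.log_le_log (hmpos _ _ _ _)
    refine max_le ((hNsub m n ω x).trans ?_) ?_
    · rw [mul_comm]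
      exact mul_le_mul (le_max_left _ _) (le_max_left _ _) (hN0 _ _ _) (hmpos _ _ _ _).le
    · have : Real.exp (-(((m + n : ℕ):ℝ) * M)) = Real.exp (-((m:ℝ) * M)) * Real.exp (-((n:ℝ) * M)) := by
        rw [← Real.exp_add]; congr 1; push_cast; ring
      rw [this]
      exact mul_le_mul (le_max_right _ _) (le_max_right _ _) (Real.exp_pos _).le (hmpos _ _ _ _).le
  have hbM : ∀ k M M' ω x, M ≤ M' → b k M' ω x ≤ b k M ω x := by
    intro k M M' ω x hM
    apply Real.log_le_log (hmpos _ _ _ _)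
    refine max_le_max le_rfl (Real.exp_le_exp.2 ?_)
    have : (M:ℝ) ≤ M' := by exact_mod_cast hM
    have h2 : (k:ℝ) * M ≤ k * M' := by gcongr
    linarith
  have hitc : ∀ ω j, Continuous fun x => ((skewMap θ Tm)^[j] (ω, x)).2 := by
    intro ω j
    induction j with
    | zero => exact continuous_id
    | succ j ih =>
      have : (fun x => ((skewMap θ Tm)^[j+1] (ω, x)).2) = fun x => Tm (θ^[j] ω) ((skewMap θ Tm)^[j] (ω, x)).2 := by
        ext x
        rw [Function.iterate_succ_apply']
        show Tm ((skewMap θ Tm)^[j] (ω, x)).1 _ = _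
        rw [skewMap_iterate_fst]
      rw [this]
      exact (hTc _).comp ih
  have hitK : ∀ ω j x, x ∈ K ω → ((skewMap θ Tm)^[j] (ω, x)).2 ∈ K (θ^[j] ω) := by
    intro ω j x hx
    induction j with
    | zero => exact hx
    | succ j ih =>
      rw [Function.iterate_succ_apply', Function.iterate_succ_apply']
      show Tm ((skewMap θ Tm)^[j] (ω, x)).1 _ ∈ _
      rw [skewMap_iterate_fst]
      exact hKinv _ ih
  have hstage : ∀ m : ℕ, ∃ (x : Ω → X) (e : Ω → ℝ), Measurable x ∧ Integrable e P ∧ 0 ≤ ∫ ω, e ω ∂P ∧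
      ∀ ω, x ω ∈ {y | ∀ j ≤ m, infDist ((skewMap θ Tm)^[j] (ω, y)).2 (K (θ^[j] ω)) < 1 / ((m : ℝ) + 1)} ∧
        e ω - 1 < F (m + 1) m ω (x ω) := by
    intro m
    refine sel P K hKc hKn hKm (F (m+1) m) (hFc _ _) (hFm _ _) _ _ (hFlow (m+1) m) (hFup (m+1) m) (r (m+1)) (hr _) ?_
      _ ?_ ?_ ?_
    · intro a ham haA haB s hs hsr hfa
      by_contra hneg
      push Not at hneg
      refine hcase ⟨m + 1, s, a, Nat.succ_pos m, hs, ham, ⟨_, fun ω => abs_le_max_abs_abs (haA ω) (haB ω)⟩, hneg, ?_⟩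
      intro ω x hx
      refine (hNb2 (m+1) m ω x).trans (Real.exp_le_exp.2 ?_)
      rw [← hFb (m+1) m ω x (hx.trans_le hsr)]
      exact hfa ω x hx
    · intro ω
      have : {y | ∀ j ≤ m, infDist ((skewMap θ Tm)^[j] (ω, y)).2 (K (θ^[j] ω)) < 1 / ((m : ℝ) + 1)} =
          ⋂ j ∈ Set.Iic m, {y | infDist ((skewMap θ Tm)^[j] (ω, y)).2 (K (θ^[j] ω)) < 1 / ((m : ℝ) + 1)} := by
        ext y; simp
      rw [this]
      exact (Set.finite_Iic m).isOpen_biInter fun j _ =>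
        isOpen_lt ((continuous_infDist_pt _).comp (hitc ω j)) continuous_const
    · intro ω y hy j _
      rw [infDist_zero_of_mem (hitK ω j y hy)]; positivity
    · intro y
      have : {ω | y ∈ {y | ∀ j ≤ m, infDist ((skewMap θ Tm)^[j] (ω, y)).2 (K (θ^[j] ω)) < 1 / ((m : ℝ) + 1)}} =
          ⋂ j ∈ Set.Iic m, {ω | infDist ((skewMap θ Tm)^[j] (ω, y)).2 (K (θ^[j] ω)) < 1 / ((m : ℝ) + 1)} := by
        ext ω; simp
      rw [this]
      refine MeasurableSet.biInter (Set.to_countable _) fun j _ => measurableSet_lt ?_ measurable_const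
      have h1 : Measurable fun ω => (skewMap θ Tm)^[j] (ω, y) := (hTh.iterate j).comp (measurable_id.prodMk measurable_const)
      have h2 : Measurable fun ω => infDist ((skewMap θ Tm)^[j] (ω, y)).2 (K ((skewMap θ Tm)^[j] (ω, y)).1) := hdm.comp h1
      simpa only [skewMap_iterate_fst] using h2
  choose x e hx he he0 hxe using hstage
  obtain ⟨μ, hμp, hμT, hμP, hμK, hμF⟩ := orbit_measure P θ θinv hθ hθim hli hri Tm hTc hTm K hKc hKn hKm x hx
    (fun m ω => (hxe m ω).1)
  refine ⟨μ, hμp, hμT, hμP, hμK, fun k => ?_⟩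
  have hkey : ∀ M : ℕ, 0 ≤ ∫ q, Function.uncurry (F (k+1) M) q ∂μ := by
    intro M
    set k' := k + 1 with hk'
    have hFabs : ∀ ω y, |F k' M ω y| ≤ max |-((k':ℝ) * M)| |C k'| := fun ω y =>
      abs_le_max_abs_abs (hFlow k' M ω y) (hFup k' M ω y)
    refine hμF (F k' M) (hFj _ _) (hFc _ _) _ hFabs 0 fun ε hε => ?_
    let Cs : ℝ := ∑ l ∈ Finset.range (k' + 1), C l
    have hCs : ∀ l ≤ k', C l ≤ Cs := fun l hl =>
      Finset.single_le_sum (f := C) (fun i _ => hC0 i) (Finset.mem_range.2 (Nat.lt_succ_of_le hl))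
    let D : ℝ := 2 * k' * Cs + k' * ((k':ℝ) * M) + k'
    have hlim0 : Tendsto (fun m : ℕ => D * (1 / ((m:ℝ) + 1))) atTop (𝓝 0) := by
      simpa using tendsto_one_div_add_atTop_nhds_zero_nat.const_mul D
    have hrl : ∀ᶠ m : ℕ in atTop, ∀ l ∈ Finset.range (k' + 1), 1 / ((m:ℝ) + 1) < r l := by
      rw [Filter.eventually_all_finset]
      intro l _
      exact tendsto_one_div_add_atTop_nhds_zero_nat.eventually (gt_mem_nhds (hr l))
    filter_upwards [hlim0.eventually (gt_mem_nhds hε), hrl, eventually_ge_atTop k', eventually_ge_atTop M] with m hm1 hm2 hm3 hm4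
    have hpt : ∀ ω, k' * (e m ω - 1) ≤ ∑ j ∈ Finset.range (m+1), Function.uncurry (F k' M) ((skewMap θ Tm)^[j] (ω, x m ω)) +
        (2 * k' * Cs + k' * ((k':ℝ) * M)) := by
      intro ω
      have hnear : ∀ j ≤ m, ∀ l ≤ k', infDist ((skewMap θ Tm)^[j] (ω, x m ω)).2 (K ((skewMap θ Tm)^[j] (ω, x m ω)).1) < r l := by
        intro j hj l hl
        have := (hxe m ω).1 j hj
        rw [skewMap_iterate_fst]
        exact this.trans (hm2 l (Finset.mem_range.2 (Nat.lt_succ_of_le hl)))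
      have h1 := subadd_sum (fun j l => b l M ((skewMap θ Tm)^[j] (ω, x m ω)).1 ((skewMap θ Tm)^[j] (ω, x m ω)).2) k' (m+1) Cs
        ((k':ℝ) * M) (by omega) (by
          intro j l1 l2
          have := hbsub l1 l2 M ((skewMap θ Tm)^[j] (ω, x m ω)).1 ((skewMap θ Tm)^[j] (ω, x m ω)).2
          rw [Prod.mk.eta, ← Function.iterate_add_apply, add_comm l1 j] at this
          exact this) (by
          intro j hj l hl
          exact (hbC l M _ _ (hnear j (by omega) l hl)).trans (hCs l hl)) (fun j => hblow _ _ _ _)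
      have h2 : ∑ j ∈ Finset.range (m+1), b k' M ((skewMap θ Tm)^[j] (ω, x m ω)).1 ((skewMap θ Tm)^[j] (ω, x m ω)).2 =
          ∑ j ∈ Finset.range (m+1), Function.uncurry (F k' M) ((skewMap θ Tm)^[j] (ω, x m ω)) := by
        refine Finset.sum_congr rfl fun j hj => ?_
        exact (hFb k' M _ _ (hnear j (by simpa [Nat.lt_succ_iff] using hj) k' le_rfl)).symm
      rw [h2] at h1
      refine le_trans ?_ h1
      refine mul_le_mul_of_nonneg_left ?_ (by positivity)
      have h3 := (hxe m ω).2
      have h4 : F (m+1) m ω (x m ω) ≤ b (m+1) m ω (x m ω) := min_le_left _ _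
      have h5 := hbM (m+1) M m ω (x m ω) hm4
      show _ ≤ b (m+1) M ω (x m ω)
      linarith
    have hFi : ∀ j, Integrable (fun ω => Function.uncurry (F k' M) ((skewMap θ Tm)^[j] (ω, x m ω))) P := fun j =>
      Integrable.of_bound ((hFj k' M).comp ((hTh.iterate j).comp (measurable_id.prodMk (hx m)))).aestronglyMeasurable _
        (ae_of_all _ fun ω => hFabs _ _)
    have hI := integral_mono (((he m).sub (integrable_const 1)).const_mul (k':ℝ))
      ((integrable_finsetSum (Finset.range (m+1)) fun j _ => hFi j).add (integrable_const (2 * k' * Cs + k' * ((k':ℝ) * M)))) hpt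
    simp only [Pi.add_apply, Pi.sub_apply] at hI
    rw [integral_const_mul, integral_sub (he m) (integrable_const 1), integral_add
      (integrable_finsetSum (Finset.range (m+1)) fun j _ => hFi j) (integrable_const _), integral_finsetSum _ fun j _ => hFi j] at hI
    simp only [integral_const, probReal_univ, smul_eq_mul, one_mul, mul_one] at hI
    have h6 : (k':ℝ) * -1 ≤ k' * (∫ ω, e m ω ∂P - 1) :=
      mul_le_mul_of_nonneg_left (by linarith [he0 m]) (by positivity)
    have h7 : -D ≤ ∑ j ∈ Finset.range (m+1), ∫ ω, Function.uncurry (F k' M) ((skewMap θ Tm)^[j] (ω, x m ω)) ∂P := by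
      simp only [D]; linarith
    have h8 : (0:ℝ) < ((m:ℝ)+1)⁻¹ := by positivity
    have h9 := mul_le_mul_of_nonneg_left h7 h8.le
    rw [one_div] at hm1
    linarith
  refine log_limit μ (fun q => N (k+1) q.1 q.2) (hNj (k+1)) (fun q => hN0 _ _ _) (C (k+1)) (hC0 _) ((k+1 : ℕ):ℝ)
    (by push_cast; linarith [(Nat.cast_nonneg k : (0:ℝ) ≤ k)]) ?_ hkey
  have hm1 : MeasurableSet {q : Ω × X | q.2 ∈ K q.1} := by
    have : {q : Ω × X | q.2 ∈ K q.1} = {q | infDist q.2 (K q.1) = 0} := by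
      ext q
      exact (hKc q.1).isClosed.mem_iff_infDist_zero (hKn q.1)
    rw [this]; exact hdm (measurableSet_singleton 0)
  filter_upwards [(mem_ae_iff_prob_eq_one hm1).2 hμK] with q hq
  refine hC (k+1) q.1 q.2 ?_
  rw [infDist_zero_of_mem hq]; exact hr _

theorem maxerg {Ω : Type*} [MeasurableSpace Ω] (P : Measure Ω) [IsProbabilityMeasure P] (S : Ω → Ω)
    (hS : MeasurePreserving S P P) (f : Ω → ℝ) (hf : Measurable f) (B : ℝ) (hB : ∀ ω, |f ω| ≤ B)
    (hae : ∀ᵐ ω ∂P, ∃ n, 0 < ∑ i ∈ Finset.range n, f (S^[i] ω)) : 0 ≤ ∫ ω, f ω ∂P := by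
  obtain ⟨M, hM0, hMs⟩ : ∃ M : ℕ → Ω → ℝ, (∀ ω, M 0 ω = 0) ∧ ∀ n ω, M (n+1) ω = max 0 (f ω + M n (S ω)) :=
    ⟨fun n => Nat.rec (fun _ => (0:ℝ)) (fun _ m ω => max 0 (f ω + m (S ω))) n, fun ω => rfl, fun n ω => rfl⟩
  have hMm : ∀ n, Measurable (M n) := by
    intro n
    induction n with
    | zero => rw [funext hM0]; exact measurable_const
    | succ n ih => rw [funext (hMs n)]; exact measurable_const.max (hf.add (ih.comp hS.measurable))
  have hMn : ∀ n ω, 0 ≤ M n ω := by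
    intro n ω
    cases n with
    | zero => rw [hM0]
    | succ n => rw [hMs]; exact le_max_left _ _
  have hMb : ∀ n : ℕ, ∃ b : ℝ, ∀ ω, M n ω ≤ b := by
    intro n
    induction n with
    | zero => exact ⟨0, fun ω => (hM0 ω).le⟩
    | succ n ih =>
      obtain ⟨b, hb⟩ := ih
      refine ⟨max 0 (B + b), fun ω => ?_⟩
      rw [hMs]
      exact max_le_max le_rfl (add_le_add ((le_abs_self _).trans (hB ω)) (hb _))
  have hMi : ∀ n, Integrable (M n) P := by
    intro n
    obtain ⟨b, hb⟩ := hMb n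
    exact Integrable.of_bound (hMm n).aestronglyMeasurable b (ae_of_all _ fun ω => by
      rw [Real.norm_of_nonneg (hMn n ω)]; exact hb ω)
  have hmono : ∀ n ω, M n ω ≤ M (n+1) ω := by
    intro n
    induction n with
    | zero => intro ω; rw [hM0]; exact hMn _ ω
    | succ n ih => intro ω; rw [hMs n, hMs (n+1)]; exact max_le_max le_rfl (by linarith [ih (S ω)])
  have hsum : ∀ n ω, ∑ i ∈ Finset.range n, f (S^[i] ω) ≤ M n ω := by
    intro n
    induction n with
    | zero => intro ω; simp [hM0]
    | succ n ih =>
      intro ω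
      rw [Finset.sum_range_succ', hMs]
      refine le_max_of_le_right ?_
      have := ih (S ω)
      simp only [Function.iterate_succ_apply, Function.iterate_zero, id]
      linarith
  have hfi : Integrable f P := Integrable.of_bound hf.aestronglyMeasurable B (ae_of_all _ hB)
  have hSi : ∀ n, Integrable (fun ω => M n (S ω)) P := fun n => hS.integrable_comp_of_integrable (hMi n)
  have hA : ∀ n, MeasurableSet {ω | 0 < M (n+1) ω} := fun n => measurableSet_lt measurable_const (hMm (n+1))
  have hstep : ∀ n, 0 ≤ ∫ ω, {ω | 0 < M (n+1) ω}.indicator f ω ∂P := by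
    intro n
    have h1 : ∫ ω, M (n+1) ω ∂P ≤ ∫ ω, ({ω | 0 < M (n+1) ω}.indicator f ω + M n (S ω)) ∂P := by
      refine integral_mono (hMi _) ((hfi.indicator (hA n)).add (hSi n)) fun ω => ?_
      by_cases h : 0 < M (n+1) ω
      · have hm : ω ∈ {ω | 0 < M (n+1) ω} := h
        simp only [Set.indicator_of_mem hm]
        rw [hMs] at h ⊢
        rcases lt_max_iff.1 h with h | h
        · exact absurd h (lt_irrefl _)
        · rw [max_eq_right h.le]
      · have hm : ω ∉ {ω | 0 < M (n+1) ω} := h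
        simp only [Set.indicator_of_notMem hm, zero_add]
        exact (not_lt.1 h).trans (hMn _ _)
    rw [integral_add (hfi.indicator (hA n)) (hSi n)] at h1
    have h2 : ∫ ω, M n (S ω) ∂P = ∫ ω, M n ω ∂P := by
      conv_rhs => rw [← hS.map_eq]
      rw [integral_map hS.measurable.aemeasurable (hMm n).aestronglyMeasurable]
    have h3 : ∫ ω, M n ω ∂P ≤ ∫ ω, M (n+1) ω ∂P := integral_mono (hMi _) (hMi _) (hmono n)
    linarith
  have htend : Tendsto (fun n => ∫ ω, {ω | 0 < M (n+1) ω}.indicator f ω ∂P) atTop (𝓝 (∫ ω, f ω ∂P)) := by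
    refine tendsto_integral_of_dominated_convergence (fun _ => B)
      (fun n => (hf.indicator (hA n)).aestronglyMeasurable) (integrable_const _) ?_ ?_
    · intro n
      exact ae_of_all _ fun ω => (norm_indicator_le_norm_self _ _).trans (hB ω)
    · filter_upwards [hae] with ω hω
      obtain ⟨n0, hn0⟩ := hω
      refine tendsto_const_nhds.congr' ?_
      filter_upwards [eventually_ge_atTop n0] with n hn
      have h1 : Monotone fun n => M n ω := monotone_nat_of_le_succ fun n => hmono n ω
      have hm : ω ∈ {ω | 0 < M (n+1) ω} := (hn0.trans_le (hsum n0 ω)).trans_le (h1 (by omega))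
      rw [Set.indicator_of_mem hm]
  exact ge_of_tendsto' htend hstep

theorem image_iter {Ω Ξ E : Type*} (θ : Ω → Ω) (g : Ω → Ξ → Ξ) (h : Ω → Ξ → E → E) (K : Ω → Set (Ξ × E))
    (hK : ∀ ω, (fun p : Ξ × E => (g ω p.1, h ω p.1 p.2)) '' K ω = K (θ ω)) (n : ℕ) (ω : Ω) :
    (fun p : Ξ × E => (giter θ g n ω p.1, hiter θ g h n ω p.1 p.2)) '' K ω = K (θ^[n] ω) := by
  induction n with
  | zero => simp [giter, hiter]
  | succ n ih =>
    rw [Function.iterate_succ_apply', ← hK, ← ih, Set.image_image]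
    rfl

theorem giter_inj {Ω Ξ : Type*} (θ : Ω → Ω) (g : Ω → Ξ → Ξ) (hg : ∀ ω, Function.Injective (g ω)) (n : ℕ) (ω : Ω) :
    Function.Injective (giter θ g n ω) := by
  induction n with
  | zero => exact fun _ _ h => h
  | succ n ih => exact (hg _).comp ih

theorem hiter_diff {Ω Ξ E : Type*} [NormedAddCommGroup E] [NormedSpace ℝ E]
    (θ : Ω → Ω) (g : Ω → Ξ → Ξ) (h : Ω → Ξ → E → E)
    (hd : ∀ ω ξ, Differentiable ℝ (h ω ξ)) (n : ℕ) (ω : Ω) (ξ : Ξ) : Differentiable ℝ (hiter θ g h n ω ξ) := by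
  induction n with
  | zero => exact differentiable_id
  | succ n ih => exact (hd _ _).comp ih

theorem contract {Ω Ξ E : Type*} [MetricSpace Ξ] [NormedAddCommGroup E] [NormedSpace ℝ E]
    (S : Ω → Ω) (g : Ω → Ξ → Ξ) (hg : ∀ ω, Function.Injective (g ω)) (h : Ω → Ξ → E → E)
    (hd : ∀ ω ξ, Differentiable ℝ (h ω ξ)) (K : Ω → Set (Ξ × E)) (hKc : ∀ ω, IsCompact (K ω))
    (hK : ∀ ω, (fun p : Ξ × E => (g ω p.1, h ω p.1 p.2)) '' K ω = K (S ω))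
    (hconn : ∀ ω ξ, IsPreconnected {y | (ξ, y) ∈ K ω}) (r : ℝ) (hr : 0 < r) (a : Ω → ℝ)
    (ha : ∀ ω (p : Ξ × E), infDist p (K ω) < r → ‖fderiv ℝ (h ω p.1) p.2‖ ≤ Real.exp (a ω))
    (δ : ℝ) (hδ : 0 < δ) (ω : Ω) (hω : ∀ n : ℕ, ∑ i ∈ Finset.range n, a (S^[i] ω) ≤ -(n * δ)) (ε : ℝ) (hε : 0 < ε) :
    ∀ᶠ n : ℕ in atTop, ∀ ξ y y', (ξ, y) ∈ K (S^[n] ω) → (ξ, y') ∈ K (S^[n] ω) → dist y y' < ε := by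
  have himg := fun n ω => image_iter S g h K hK n ω
  have hloc : ∀ (n : ℕ) ξ y y', (ξ, y) ∈ K ω → dist y' y < r →
      dist (hiter S g h n ω ξ y') (hiter S g h n ω ξ y) ≤ Real.exp (∑ i ∈ Finset.range n, a (S^[i] ω)) * dist y' y := by
    intro n ξ y y' hy hyy
    induction n with
    | zero => simp [hiter]
    | succ n ih =>
      have hle1 : Real.exp (∑ i ∈ Finset.range n, a (S^[i] ω)) ≤ 1 := by
        rw [Real.exp_le_one_iff]
        have : (0:ℝ) ≤ n * δ := by positivity
        linarith [hω n]
      have h1 : dist (hiter S g h n ω ξ y') (hiter S g h n ω ξ y) < r :=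
        (ih.trans (mul_le_of_le_one_left dist_nonneg hle1)).trans_lt hyy
      have hmem : (giter S g n ω ξ, hiter S g h n ω ξ y) ∈ K (S^[n] ω) := by
        rw [← himg]; exact ⟨(ξ, y), hy, rfl⟩
      have h2 := (convex_ball (hiter S g h n ω ξ y) r).norm_image_sub_le_of_norm_fderiv_le (𝕜 := ℝ)
        (f := h (S^[n] ω) (giter S g n ω ξ)) (C := Real.exp (a (S^[n] ω))) (x := hiter S g h n ω ξ y)
        (y := hiter S g h n ω ξ y') (fun x _ => (hd _ _) x) (by
          intro x hx
          refine ha (S^[n] ω) (giter S g n ω ξ, x) ?_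
          refine (infDist_le_dist_of_mem hmem).trans_lt ?_
          rw [Prod.dist_eq]
          simp only [dist_self]
          exact max_lt hr hx) (mem_ball_self hr) h1
      rw [← dist_eq_norm, ← dist_eq_norm] at h2
      rw [Finset.sum_range_succ, Real.exp_add]
      refine le_trans h2 ?_
      have h3 := mul_le_mul_of_nonneg_left ih (Real.exp_pos (a (S^[n] ω))).le
      calc _ ≤ _ := h3
        _ = _ := by ring
  have hc2 : IsCompact (Prod.snd '' K ω) := (hKc ω).image continuous_snd
  obtain ⟨t, -, htf, htc⟩ := hc2.finite_cover_balls (e := r / 2) (by positivity)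
  have htend : Tendsto (fun n : ℕ => (htf.toFinset.card : ℝ) * (r * Real.exp (-(n * δ)))) atTop (𝓝 0) := by
    have h1 : Tendsto (fun n : ℕ => Real.exp (-(n * δ))) atTop (𝓝 0) := by
      refine Real.tendsto_exp_neg_atTop_nhds_zero.comp ?_
      exact Tendsto.atTop_mul_const hδ tendsto_natCast_atTop_atTop
    simpa using (h1.const_mul r).const_mul (htf.toFinset.card : ℝ)
  filter_upwards [htend.eventually (gt_mem_nhds hε)] with n hn ξ z z' hz hz'
  refine lt_of_le_of_lt ?_ hn
  rw [← himg] at hz hz'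
  obtain ⟨⟨ξ1, y⟩, hy, hey⟩ := hz
  obtain ⟨⟨ξ2, y'⟩, hy', hey'⟩ := hz'
  simp only [Prod.mk.injEq] at hey hey'
  have hξ : ξ2 = ξ1 := giter_inj S g hg n ω (hey'.1.trans hey.1.symm)
  subst hξ
  let F : E → ℝ := fun v => dist (hiter S g h n ω ξ2 y) (hiter S g h n ω ξ2 v)
  have hFc : Continuous F := continuous_const.dist (hiter_diff S g h hd n ω ξ2).continuous
  have hpre : IsPreconnected (F '' {v | (ξ2, v) ∈ K ω}) := (hconn ω ξ2).image F hFc.continuousOn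
  have h0 : (0:ℝ) ∈ F '' {v | (ξ2, v) ∈ K ω} := ⟨y, hy, dist_self _⟩
  have hD : dist z z' ∈ F '' {v | (ξ2, v) ∈ K ω} := ⟨y', hy', by simp only [F]; rw [hey.2, hey'.2]⟩
  have hIcc : Set.Icc 0 (dist z z') ⊆ F '' {v | (ξ2, v) ∈ K ω} := hpre.ordConnected.out h0 hD
  have hcov : F '' {v | (ξ2, v) ∈ K ω} ⊆ ⋃ c ∈ htf.toFinset, F '' ({v | (ξ2, v) ∈ K ω} ∩ ball c (r/2)) := by
    rintro _ ⟨v, hv, rfl⟩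
    have := htc ⟨(ξ2, v), hv, rfl⟩
    simp only [Set.mem_iUnion] at this ⊢
    obtain ⟨c, hc, hvc⟩ := this
    exact ⟨c, htf.mem_toFinset.2 hc, v, ⟨hv, hvc⟩, rfl⟩
  have hvol : ∀ c ∈ htf.toFinset, volume (F '' ({v | (ξ2, v) ∈ K ω} ∩ ball c (r/2))) ≤
      ENNReal.ofReal (r * Real.exp (-(n * δ))) := by
    intro c _
    refine (Real.volume_le_diam _).trans ?_
    refine Metric.ediam_le ?_
    rintro _ ⟨v, ⟨hv, hvc⟩, rfl⟩ _ ⟨v', ⟨hv', hvc'⟩, rfl⟩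
    rw [edist_dist]
    apply ENNReal.ofReal_le_ofReal
    have hvv : dist v' v < r := by
      have h1 := mem_ball.1 hvc
      have h2 := mem_ball.1 hvc'
      have := dist_triangle_right v' v c
      linarith
    have h3 := hloc n ξ2 v v' hv hvv
    have h4 : dist (F v) (F v') ≤ dist (hiter S g h n ω ξ2 v') (hiter S g h n ω ξ2 v) := by
      rw [Real.dist_eq, dist_comm (hiter S g h n ω ξ2 v')]
      simp only [F]
      rw [dist_comm (hiter S g h n ω ξ2 y), dist_comm (hiter S g h n ω ξ2 y)]
      exact abs_dist_sub_le _ _ _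
    have h5 : Real.exp (∑ i ∈ Finset.range n, a (S^[i] ω)) ≤ Real.exp (-(n * δ)) := Real.exp_le_exp.2 (hω n)
    calc _ ≤ _ := h4
      _ ≤ _ := h3
      _ ≤ Real.exp (-(n * δ)) * r := mul_le_mul h5 hvv.le dist_nonneg (Real.exp_pos _).le
      _ = _ := mul_comm _ _
  have hfin : ENNReal.ofReal (dist z z') ≤ ENNReal.ofReal ((htf.toFinset.card : ℝ) * (r * Real.exp (-(n * δ)))) := by
    calc ENNReal.ofReal (dist z z') = volume (Set.Icc 0 (dist z z')) := by rw [Real.volume_Icc, sub_zero]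
      _ ≤ volume (⋃ c ∈ htf.toFinset, F '' ({v | (ξ2, v) ∈ K ω} ∩ ball c (r/2))) := measure_mono (hIcc.trans hcov)
      _ ≤ ∑ c ∈ htf.toFinset, volume (F '' ({v | (ξ2, v) ∈ K ω} ∩ ball c (r/2))) := measure_biUnion_finset_le _ _
      _ ≤ ∑ c ∈ htf.toFinset, ENNReal.ofReal (r * Real.exp (-(n * δ))) := Finset.sum_le_sum hvol
      _ = _ := by
        rw [Finset.sum_const, nsmul_eq_mul, ENNReal.ofReal_mul (Nat.cast_nonneg _), ENNReal.ofReal_natCast]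
  exact (ENNReal.ofReal_le_ofReal_iff (by positivity)).1 hfin

theorem meas_spread {Ω Ξ E : Type*} [MeasurableSpace Ω] [MetricSpace Ξ] [NormedAddCommGroup E]
    [TopologicalSpace.SeparableSpace (Ξ × E)]
    (K : Ω → Set (Ξ × E)) (hKc : ∀ ω, IsCompact (K ω)) (hKn : ∀ ω, (K ω).Nonempty)
    (hKm : ∀ x, Measurable fun ω => infDist x (K ω)) (ε : ℝ) :
    MeasurableSet {ω | ∃ p ∈ K ω, ∃ p' ∈ K ω, p.1 = p'.1 ∧ ε ≤ dist p.2 p'.2} := by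
  rcases isEmpty_or_nonempty Ω with hΩ | ⟨⟨ω0⟩⟩
  · rw [Set.eq_empty_of_isEmpty {ω | ∃ p ∈ K ω, ∃ p' ∈ K ω, p.1 = p'.1 ∧ ε ≤ dist p.2 p'.2}]
    exact MeasurableSet.empty
  have : Nonempty (Ξ × E) := (hKn ω0).to_type
  let q : ℕ → Ξ × E := TopologicalSpace.denseSeq (Ξ × E)
  have hq : DenseRange q := TopologicalSpace.denseRange_denseSeq _
  have heq : {ω | ∃ p ∈ K ω, ∃ p' ∈ K ω, p.1 = p'.1 ∧ ε ≤ dist p.2 p'.2} =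
      ⋂ m : ℕ, ⋃ i : ℕ, ⋃ i' : ℕ, {ω | infDist (q i) (K ω) < 1 / ((m:ℝ)+1) ∧ infDist (q i') (K ω) < 1 / ((m:ℝ)+1) ∧
        dist (q i).1 (q i').1 < 3 * (1 / ((m:ℝ)+1)) ∧ ε - 3 * (1 / ((m:ℝ)+1)) < dist (q i).2 (q i').2} := by
    ext ω
    simp only [Set.mem_ofPred_eq, Set.mem_iInter, Set.mem_iUnion]
    constructor
    · rintro ⟨p, hp, p', hp', h1, h2⟩ m
      have hm : (0:ℝ) < 1 / ((m:ℝ)+1) := by positivity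
      obtain ⟨i, hi⟩ := hq.exists_dist_lt p hm
      obtain ⟨i', hi'⟩ := hq.exists_dist_lt p' hm
      rw [Prod.dist_eq, max_lt_iff] at hi hi'
      refine ⟨i, i', ?_, ?_, ?_, ?_⟩
      · refine (infDist_le_dist_of_mem hp).trans_lt ?_
        rw [dist_comm, Prod.dist_eq]; exact max_lt hi.1 hi.2
      · refine (infDist_le_dist_of_mem hp').trans_lt ?_
        rw [dist_comm, Prod.dist_eq]; exact max_lt hi'.1 hi'.2
      · have := dist_triangle4 (q i).1 p.1 p'.1 (q i').1
        rw [h1, dist_self, dist_comm, dist_comm (q i).1] at this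
        rw [h1] at hi
        rw [dist_comm]
        linarith [hi.1, hi'.1]
      · have := dist_triangle4 p.2 (q i).2 (q i').2 p'.2
        rw [dist_comm (q i').2] at this
        linarith [hi.2, hi'.2]
    · intro H
      let G : (Ξ × E) × (Ξ × E) → ℝ := fun z => max (dist z.1.1 z.2.1) (ε - dist z.1.2 z.2.2)
      have hG : Continuous G := by fun_prop
      obtain ⟨⟨p, p'⟩, ⟨hp, hp'⟩, hmin⟩ := ((hKc ω).prod (hKc ω)).exists_isMinOn ((hKn ω).prod (hKn ω)) hG.continuousOn
      have hle : ∀ m : ℕ, G (p, p') ≤ 5 * (1 / ((m:ℝ)+1)) := by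
        intro m
        obtain ⟨i, i', h1, h2, h3, h4⟩ := H m
        obtain ⟨z, hz, hz1⟩ := (infDist_lt_iff (hKn ω)).1 h1
        obtain ⟨z', hz', hz1'⟩ := (infDist_lt_iff (hKn ω)).1 h2
        rw [Prod.dist_eq, max_lt_iff] at hz1 hz1'
        refine (hmin (Set.mk_mem_prod hz hz')).trans (max_le ?_ ?_)
        · have := dist_triangle4 z.1 (q i).1 (q i').1 z'.1
          rw [dist_comm z.1 (q i).1] at this
          simp only
          linarith [hz1.1, hz1'.1]
        · have := dist_triangle4 (q i).2 z.2 z'.2 (q i').2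
          rw [dist_comm z'.2] at this
          simp only
          linarith [hz1.2, hz1'.2]
      have h0 : G (p, p') ≤ 0 := by
        refine ge_of_tendsto' (x := atTop) (f := fun m : ℕ => 5 * (1 / ((m:ℝ)+1))) ?_ hle
        simpa using tendsto_one_div_add_atTop_nhds_zero_nat.const_mul (5:ℝ)
      have h1 := (le_max_left _ _).trans h0
      have h2 := (le_max_right _ _).trans h0
      refine ⟨p, hp, p', hp', dist_le_zero.1 h1, ?_⟩
      simp only at h2
      linarith
  rw [heq]
  refine MeasurableSet.iInter fun m => MeasurableSet.iUnion fun i => MeasurableSet.iUnion fun i' => ?_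
  exact (measurableSet_lt (hKm _) measurable_const).inter ((measurableSet_lt (hKm _) measurable_const).inter
    ((MeasurableSet.const _).inter (MeasurableSet.const _)))

theorem coreB {Ω Ξ E : Type*} [MeasurableSpace Ω] [MetricSpace Ξ] [NormedAddCommGroup E] [NormedSpace ℝ E]
    [TopologicalSpace.SeparableSpace (Ξ × E)] (P : Measure Ω) [IsProbabilityMeasure P]
    (θ : Ω → Ω) (hθ : Ergodic θ P) (g : Ω → Ξ → Ξ) (hg : ∀ ω, Function.Injective (g ω)) (h : Ω → Ξ → E → E)
    (hd : ∀ ω ξ, Differentiable ℝ (h ω ξ)) (K : Ω → Set (Ξ × E)) (hKc : ∀ ω, IsCompact (K ω))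
    (hKn : ∀ ω, (K ω).Nonempty) (hKm : ∀ x, Measurable fun ω => infDist x (K ω))
    (hK : ∀ ω, (fun p : Ξ × E => (g ω p.1, h ω p.1 p.2)) '' K ω = K (θ ω))
    (hconn : ∀ ω ξ, IsPreconnected {y | (ξ, y) ∈ K ω}) (k : ℕ) (r : ℝ) (hr : 0 < r) (a : Ω → ℝ)
    (ham : Measurable a) (B : ℝ) (haB : ∀ ω, |a ω| ≤ B) (hneg : ∫ ω, a ω ∂P < 0)
    (ha : ∀ ω (p : Ξ × E), infDist p (K ω) < r → ‖fderiv ℝ (hiter θ g h k ω p.1) p.2‖ ≤ Real.exp (a ω)) :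
    ∀ᵐ ω ∂P, ∀ ξ y y', (ξ, y) ∈ K ω → (ξ, y') ∈ K ω → y = y' := by
  have hS := hθ.toMeasurePreserving.iterate k
  set δ : ℝ := -(∫ ω, a ω ∂P) / 2 with hδdef
  have hδ : 0 < δ := by rw [hδdef]; linarith
  have hai : Integrable a P := Integrable.of_bound ham.aestronglyMeasurable B (ae_of_all _ haB)
  have hnot : ¬ ∀ᵐ ω ∂P, ∃ n, 0 < ∑ i ∈ Finset.range n, (fun ω => a ω + δ) ((θ^[k])^[i] ω) := by
    intro hall
    have := maxerg P (θ^[k]) hS (fun ω => a ω + δ) (ham.add_const δ) (B + |δ|)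
      (fun ω => (abs_add_le _ _).trans (by linarith [haB ω])) hall
    rw [integral_add hai (integrable_const _)] at this
    simp at this
    linarith
  let Es : ℕ → Set Ω := fun j => {ω | ∃ p ∈ K ω, ∃ p' ∈ K ω, p.1 = p'.1 ∧ 1 / ((j:ℝ) + 1) ≤ dist p.2 p'.2}
  have hEm : ∀ j, MeasurableSet (Es j) := fun j => meas_spread K hKc hKn hKm _
  have hrec : ∀ᵐ ω ∂P, ∀ j, ω ∈ Es j → ∃ᶠ n in atTop, (θ^[k])^[n] ω ∈ Es j := by
    rw [ae_all_iff]
    intro j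
    exact hS.conservative.ae_mem_imp_frequently_image_mem (hEm j).nullMeasurableSet
  let Gd : Set Ω := ⋂ j, (Es j)ᶜ
  have hGm : MeasurableSet Gd := MeasurableSet.iInter fun j => (hEm j).compl
  have hGiff : ∀ ω, ω ∈ Gd ↔ ∀ ξ y y', (ξ, y) ∈ K ω → (ξ, y') ∈ K ω → y = y' := by
    intro ω
    simp only [Gd, Set.mem_iInter, Set.mem_compl_iff]
    constructor
    · intro H ξ y y' hy hy'
      by_contra hne
      obtain ⟨j, hj⟩ := exists_nat_one_div_lt (dist_pos.2 hne)
      exact H j ⟨(ξ, y), hy, (ξ, y'), hy', rfl, hj.le⟩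
    · rintro H j ⟨⟨ξ, y⟩, hp, ⟨ξ', y'⟩, hp', h1, h2⟩
      simp only at h1 h2
      subst h1
      rw [H ξ y y' hp hp', dist_self] at h2
      have : (0:ℝ) < 1 / ((j:ℝ)+1) := by positivity
      linarith
  have hsub : Gd ⊆ θ ⁻¹' Gd := by
    intro ω hω
    rw [Set.mem_preimage, hGiff]
    rw [hGiff] at hω
    intro ξ y y' hy hy'
    rw [← hK] at hy hy'
    obtain ⟨⟨ξ1, z⟩, hz, hez⟩ := hy
    obtain ⟨⟨ξ2, z'⟩, hz', hez'⟩ := hy'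
    simp only [Prod.mk.injEq] at hez hez'
    have hξ : ξ2 = ξ1 := hg ω (hez'.1.trans hez.1.symm)
    subst hξ
    rw [← hez.2, ← hez'.2, hω ξ2 z z' hz hz']
  have hGpos : ¬ (Gd =ᵐ[P] (∅ : Set Ω)) := by
    intro hG0
    apply hnot
    filter_upwards [hrec, hG0] with ω hω hω0
    by_contra hno
    push Not at hno
    have hωn : ω ∉ Gd := by
      intro hmem
      have : Gd ω = (∅ : Set Ω) ω := hω0
      have h2 : (∅ : Set Ω) ω := this ▸ hmem
      exact h2
    apply hωn
    simp only [Gd, Set.mem_iInter, Set.mem_compl_iff]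
    intro j hj
    have hc := contract (θ^[k]) (giter θ g k) (giter_inj θ g hg k) (hiter θ g h k) (hiter_diff θ g h hd k) K hKc
      (image_iter θ g h K hK k) hconn r hr a ha δ hδ ω (by
        intro n
        have := hno n
        rw [Finset.sum_add_distrib] at this
        simp at this
        linarith) (1 / ((j:ℝ) + 1)) (by positivity)
    refine hω j hj ?_
    filter_upwards [hc] with n hn
    rintro ⟨⟨ξ, y⟩, hp, ⟨ξ', y'⟩, hp', h1, h2⟩
    simp only at h1 h2
    subst h1
    exact absurd (hn ξ y y' hp hp') (not_lt.2 h2)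
  have := hθ.ae_empty_or_univ_of_ae_le_preimage hGm.nullMeasurableSet (ae_of_all _ hsub)
  rcases this with h0 | h1
  · exact absurd h0 hGpos
  · filter_upwards [eventuallyEq_univ.1 h1] with ω hω
    exact (hGiff ω).1 hω

/-- the fibre map of the double skew product -/
def fibMap {Ω Ξ E : Type*} (g : Ω → Ξ → Ξ) (h : Ω → Ξ → E → E) (ω : Ω) (p : Ξ × E) : Ξ × E :=
  (g ω p.1, h ω p.1 p.2)

theorem skew_iter {Ω Ξ E : Type*} (θ : Ω → Ω) (g : Ω → Ξ → Ξ) (h : Ω → Ξ → E → E) (n : ℕ) (ω : Ω) (p : Ξ × E) :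
    (skewMap θ (fibMap g h))^[n] (ω, p) = (θ^[n] ω, (giter θ g n ω p.1, hiter θ g h n ω p.1 p.2)) := by
  induction n with
  | zero => rfl
  | succ n ih => rw [Function.iterate_succ_apply', ih, Function.iterate_succ_apply']; rfl

theorem hiter_add {Ω Ξ E : Type*} (θ : Ω → Ω) (g : Ω → Ξ → Ξ) (h : Ω → Ξ → E → E) (m n : ℕ) (ω : Ω) (ξ : Ξ) :
    hiter θ g h (m + n) ω ξ = hiter θ g h n (θ^[m] ω) (giter θ g m ω ξ) ∘ hiter θ g h m ω ξ := by
  ext y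
  have := skew_iter θ g h (m + n) ω (ξ, y)
  rw [add_comm, Function.iterate_add_apply, skew_iter, skew_iter, add_comm] at this
  simp only [Prod.mk.injEq] at this
  exact this.2.2.symm

theorem giter_cont {Ω Ξ : Type*} [TopologicalSpace Ξ] (θ : Ω → Ω) (g : Ω → Ξ → Ξ) (hgc : ∀ ω, Continuous (g ω)) (n : ℕ) (ω : Ω) :
    Continuous (giter θ g n ω) := by
  induction n with
  | zero => exact continuous_id
  | succ n ih => exact (hgc _).comp ih

theorem hiter_cont {Ω Ξ E : Type*} [TopologicalSpace Ξ] [TopologicalSpace E] (θ : Ω → Ω) (g : Ω → Ξ → Ξ) (h : Ω → Ξ → E → E)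
    (hgc : ∀ ω, Continuous (g ω)) (hhc : ∀ ω, Continuous fun p : Ξ × E => h ω p.1 p.2) (n : ℕ) (ω : Ω) :
    Continuous fun p : Ξ × E => hiter θ g h n ω p.1 p.2 := by
  induction n with
  | zero => exact continuous_snd
  | succ n ih => exact (hhc (θ^[n] ω)).comp (((giter_cont θ g hgc n ω).comp continuous_fst).prodMk ih)

theorem hiter_fderiv_add {Ω Ξ E : Type*} [NormedAddCommGroup E] [NormedSpace ℝ E]
    (θ : Ω → Ω) (g : Ω → Ξ → Ξ) (h : Ω → Ξ → E → E)
    (hd : ∀ ω ξ, Differentiable ℝ (h ω ξ)) (m n : ℕ) (ω : Ω) (ξ : Ξ) (y : E) :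
    fderiv ℝ (hiter θ g h (m + n) ω ξ) y =
      (fderiv ℝ (hiter θ g h n (θ^[m] ω) (giter θ g m ω ξ)) (hiter θ g h m ω ξ y)).comp (fderiv ℝ (hiter θ g h m ω ξ) y) := by
  rw [hiter_add, fderiv_comp]
  · exact hiter_diff θ g h hd _ _ _ _
  · exact hiter_diff θ g h hd _ _ _ _

theorem hiter_fderiv_cont {Ω Ξ E : Type*} [TopologicalSpace Ξ] [NormedAddCommGroup E] [NormedSpace ℝ E]
    (θ : Ω → Ω) (g : Ω → Ξ → Ξ) (h : Ω → Ξ → E → E)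
    (hgc : ∀ ω, Continuous (g ω)) (hhc : ∀ ω, Continuous fun p : Ξ × E => h ω p.1 p.2)
    (hd : ∀ ω ξ, Differentiable ℝ (h ω ξ)) 
    (hhD : ∀ ω, Continuous fun p : Ξ × E => fderiv ℝ (h ω p.1) p.2) (n : ℕ) (ω : Ω) :
    Continuous fun p : Ξ × E => fderiv ℝ (hiter θ g h n ω p.1) p.2 := by
  induction n with
  | zero =>
    have : (fun p : Ξ × E => fderiv ℝ (hiter θ g h 0 ω p.1) p.2) = fun _ => ContinuousLinearMap.id ℝ E := by
      ext1 p
      exact fderiv_id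
    rw [this]; exact continuous_const
  | succ n ih =>
    have : (fun p : Ξ × E => fderiv ℝ (hiter θ g h (n+1) ω p.1) p.2) = fun p =>
        (fderiv ℝ (h (θ^[n] ω) (giter θ g n ω p.1)) (hiter θ g h n ω p.1 p.2)).comp (fderiv ℝ (hiter θ g h n ω p.1) p.2) := by
      ext1 p
      exact fderiv_comp p.2 (hd _ _ _) (hiter_diff θ g h hd _ _ _ _)
    rw [this]
    exact ((hhD (θ^[n] ω)).comp (((giter_cont θ g hgc n ω).comp continuous_fst).prodMk (hiter_cont θ g h hgc hhc n ω))).clm_comp ih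

theorem meas_norm_fderiv {Ω : Type*} [MeasurableSpace Ω] {d : ℕ}
    (F : Ω → EuclideanSpace ℝ (Fin d) → EuclideanSpace ℝ (Fin d)) (hF : ∀ ω, Differentiable ℝ (F ω))
    (hFm : ∀ y, Measurable fun ω => F ω y) (y : EuclideanSpace ℝ (Fin d)) :
    Measurable fun ω => ‖fderiv ℝ (F ω) y‖ := by
  have hap : ∀ v, Measurable fun ω => fderiv ℝ (F ω) y v := by
    intro v
    refine measurable_of_tendsto_metrizable
      (f := fun (n : ℕ) ω => (n:ℝ) • (F ω (y + (n:ℝ)⁻¹ • v) - F ω y)) ?_ ?_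
    · intro n
      exact ((hFm (y + (n:ℝ)⁻¹ • v)).sub (hFm y)).const_smul (n:ℝ)
    · rw [tendsto_pi_nhds]
      intro ω
      exact ((hF ω) y).hasFDerivAt.lim v (c := fun n : ℕ => (n:ℝ)) (l := atTop) (by
        simpa using tendsto_natCast_atTop_atTop (R := ℝ))
  let Φ : (Fin d → EuclideanSpace ℝ (Fin d)) → ℝ := fun v => ‖∑ i, (EuclideanSpace.proj i : EuclideanSpace ℝ (Fin d) →L[ℝ] ℝ).smulRight (v i)‖
  have hΦ : Continuous Φ := by
    refine (continuous_finsetSum _ fun i _ => ?_).norm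
    exact ((ContinuousLinearMap.smulRightL ℝ (EuclideanSpace ℝ (Fin d)) (EuclideanSpace ℝ (Fin d))
      (EuclideanSpace.proj i)).continuous).comp (continuous_apply i)
  have heq : (fun ω => ‖fderiv ℝ (F ω) y‖) = fun ω => Φ (fun i => fderiv ℝ (F ω) y (EuclideanSpace.single i 1)) := by
    ext ω
    simp only [Φ]
    congr 1
    ext1 v
    conv_lhs => rw [show v = ∑ i, v i • EuclideanSpace.single i (1:ℝ) by
      ext j; simp [Pi.single_apply]]
    simp
  rw [heq]
  exact hΦ.measurable.comp (measurable_pi_lambda _ fun i => hap _)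


theorem coreC {Ω Ξ : Type*} [MeasurableSpace Ω] [MetricSpace Ξ] [CompactSpace Ξ]
    [MeasurableSpace Ξ] [BorelSpace Ξ] {d : ℕ}
    (P : Measure Ω) [IsProbabilityMeasure P]
    (θ θinv : Ω → Ω) (hθim : Measurable θinv)
    (hli : Function.LeftInverse θinv θ) (hri : Function.RightInverse θinv θ)
    (herg : Ergodic θ P)
    (g : Ω → Ξ → Ξ) (hgc : ∀ ω, Continuous (g ω))
    (hgb : ∀ ω, Function.Injective (g ω))
    (hgm : ∀ ξ, Measurable fun ω => g ω ξ)
    (h : Ω → Ξ → EuclideanSpace ℝ (Fin d) → EuclideanSpace ℝ (Fin d))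
    (hhc : ∀ ω, Continuous fun p : Ξ × EuclideanSpace ℝ (Fin d) => h ω p.1 p.2)
    (hhd : ∀ ω ξ, Differentiable ℝ (h ω ξ))
    (hhD : ∀ ω, Continuous fun p : Ξ × EuclideanSpace ℝ (Fin d) =>
      fderiv ℝ (h ω p.1) p.2)
    (hhm : ∀ ξ y, Measurable fun ω => h ω ξ y)
    (K : Ω → Set (Ξ × EuclideanSpace ℝ (Fin d))) (hKc : ∀ ω, IsCompact (K ω)) (hKn : ∀ ω, (K ω).Nonempty)
    (hKm : ∀ p, Measurable fun ω => infDist p (K ω))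
    (hK : ∀ ω, (fun p : Ξ × EuclideanSpace ℝ (Fin d) => (g ω p.1, h ω p.1 p.2)) '' K ω = K (θ ω))
    (hconn : ∀ ω ξ, IsPreconnected {y | (ξ, y) ∈ K ω})
    (hsup : ∀ k : ℕ, ∃ r > (0 : ℝ), ∃ C : ℝ, ∀ ω (p : Ξ × EuclideanSpace ℝ (Fin d)),
        infDist p (K ω) < r → ‖fderiv ℝ (hiter θ g h k ω p.1) p.2‖ ≤ Real.exp C)
    (hlyap : ∀ μ : Measure (Ω × Ξ × EuclideanSpace ℝ (Fin d)),
      IsProbabilityMeasure μ → μ.map (skewMap θ (fibMap g h)) = μ →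
      μ.map Prod.fst = P → μ {q | q.2 ∈ K q.1} = 1 →
      ∃ n : ℕ, ∫ q : Ω × Ξ × EuclideanSpace ℝ (Fin d),
        Real.log ‖fderiv ℝ (hiter θ g h (n + 1) q.1 q.2.1) q.2.2‖ ∂μ < 0) :
    ∀ᵐ ω ∂P, ∀ ξ y y', (ξ, y) ∈ K ω → (ξ, y') ∈ K ω → y = y' := by
  have hTc : ∀ ω, Continuous (fibMap g h ω) := fun ω => ((hgc ω).comp continuous_fst).prodMk (hhc ω)
  have hTm : ∀ p, Measurable fun ω => fibMap g h ω p := fun p => (hgm p.1).prodMk (hhm p.1 p.2)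
  have hcar : Measurable (Function.uncurry (fibMap g h)) := carath (fibMap g h) hTc hTm
  have hTh : Measurable (skewMap θ (fibMap g h)) := (herg.measurable.comp measurable_fst).prodMk hcar
  have hhitm : ∀ n ξ y, Measurable fun ω => hiter θ g h n ω ξ y := by
    intro n ξ y
    have h1 : Measurable fun ω : Ω => (skewMap θ (fibMap g h))^[n] (ω, (ξ, y)) :=
      (hTh.iterate n).comp (measurable_id.prodMk measurable_const)
    simp only [skew_iter] at h1
    exact h1.snd.snd
  rcases coreA P θ θinv herg.toMeasurePreserving hθim hli hri (fibMap g h) hTc hTm K hKc hKn hKm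
    (fun ω p hp => by rw [← hK]; exact ⟨p, hp, rfl⟩)
    (fun k ω p => ‖fderiv ℝ (hiter θ g h k ω p.1) p.2‖) (fun k ω p => norm_nonneg _)
    (fun k ω => (hiter_fderiv_cont θ g h hgc hhc hhd hhD k ω).norm)
    (fun k p => meas_norm_fderiv (fun ω => hiter θ g h k ω p.1) (fun ω => hiter_diff θ g h hhd k ω p.1)
      (fun y => hhitm k p.1 y) p.2)
    (by
      intro m n ω p
      rw [skew_iter, hiter_fderiv_add θ g h hhd]
      exact ContinuousLinearMap.opNorm_comp_le _ _) hsup with hA | hB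
  · obtain ⟨k, r, a, hk, hr, ham, ⟨B, hB⟩, hneg, ha⟩ := hA
    exact coreB P θ herg g hgb h hhd K hKc hKn hKm hK hconn k r hr a ham B hB hneg ha
  · obtain ⟨μ, hμp, hμT, hμP, hμK, hμ⟩ := hB
    obtain ⟨n, hn⟩ := hlyap μ hμp hμT hμP hμK
    exact absurd (hμ n) (not_le.2 hn)

theorem graph_of_unique {Ω Ξ E : Type*} [MeasurableSpace Ω] [MetricSpace Ξ] [NormedAddCommGroup E]
    [TopologicalSpace.SeparableSpace E] [MeasurableSpace E] [BorelSpace E] (P : Measure Ω)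
    (K : Ω → Set (Ξ × E)) (hKc : ∀ ω, IsCompact (K ω))
    (hKm : ∀ x, Measurable fun ω => infDist x (K ω))
    (hex : ∀ᵐ ω ∂P, ∀ ξ, ∃ y, (ξ, y) ∈ K ω)
    (hun : ∀ᵐ ω ∂P, ∀ ξ y y', (ξ, y) ∈ K ω → (ξ, y') ∈ K ω → y = y') :
    ∃ φ : Ω → Ξ → E, (∀ ξ, Measurable fun ω => φ ω ξ) ∧
      ∀ᵐ ω ∂P, Continuous (φ ω) ∧ K ω = {p | p.2 = φ ω p.1} := by
  classical
  have hboth : ∀ᵐ ω ∂P, ∀ ξ, ∃ y, (ξ, y) ∈ K ω ∧ ∀ y', (ξ, y') ∈ K ω → y' = y := by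
    filter_upwards [hex, hun] with ω h1 h2 ξ
    obtain ⟨y, hy⟩ := h1 ξ
    exact ⟨y, hy, fun y' hy' => h2 ξ y' y hy' hy⟩
  obtain ⟨s, hs, hsm, hs0⟩ := exists_measurable_superset_of_null (ae_iff.1 hboth)
  have hgood : ∀ ω, ω ∉ s → ∀ ξ, ∃ y, (ξ, y) ∈ K ω ∧ ∀ y', (ξ, y') ∈ K ω → y' = y := by
    intro ω hω
    by_contra hno
    exact hω (hs hno)
  let φ : Ω → Ξ → E := fun ω ξ => if hω : ω ∉ s then (hgood ω hω ξ).choose else 0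
  have hφ : ∀ ω, ω ∉ s → ∀ ξ, (ξ, φ ω ξ) ∈ K ω ∧ ∀ y', (ξ, y') ∈ K ω → y' = φ ω ξ := by
    intro ω hω ξ
    simp only [φ, dif_pos hω]
    exact (hgood ω hω ξ).choose_spec
  have hφ0 : ∀ ω, ω ∈ s → ∀ ξ, φ ω ξ = 0 := by
    intro ω hω ξ
    simp only [φ]
    rw [dif_neg (not_not.2 hω)]
  refine ⟨φ, fun ξ => ?_, ?_⟩
  · refine measurable_of_isClosed fun C hC => ?_
    rcases C.eq_empty_or_nonempty with rfl | hCn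
    · simp
    let q : ℕ → E := TopologicalSpace.denseSeq E
    have hq : DenseRange q := TopologicalSpace.denseRange_denseSeq _
    have heq : (fun ω => φ ω ξ) ⁻¹' C = (sᶜ ∩ ⋂ m : ℕ, ⋃ i : ℕ,
        ({ω | infDist (ξ, q i) (K ω) < 1 / ((m:ℝ)+1)} ∩ {_ω | infDist (q i) C < 1 / ((m:ℝ)+1)})) ∪ (s ∩ {_ω | (0:E) ∈ C}) := by
      ext ω
      by_cases hω : ω ∈ s
      · simp [hω, hφ0 ω hω ξ]
      · have h1 := (hφ ω hω ξ).1
        have hKn : (K ω).Nonempty := ⟨_, h1⟩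
        have : ω ∈ (fun ω => φ ω ξ) ⁻¹' C ↔ ∀ m : ℕ, ∃ i : ℕ, infDist (ξ, q i) (K ω) < 1 / ((m:ℝ)+1) ∧ infDist (q i) C < 1 / ((m:ℝ)+1) := by
          constructor
          · intro hmem m
            have hm : (0:ℝ) < 1 / ((m:ℝ)+1) := by positivity
            obtain ⟨i, hi⟩ := hq.exists_dist_lt (φ ω ξ) hm
            rw [dist_comm] at hi
            have hmem' : φ ω ξ ∈ C := hmem
            refine ⟨i, ?_, (infDist_le_dist_of_mem hmem').trans_lt hi⟩
            refine (infDist_le_dist_of_mem h1).trans_lt ?_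
            rw [Prod.dist_eq]
            simp only [dist_self]
            exact max_lt hm hi
          · intro H
            let G : Ξ × E → ℝ := fun z => max (dist z.1 ξ) (infDist z.2 C)
            have hG : Continuous G := (continuous_fst.dist continuous_const).max
              ((continuous_infDist_pt C).comp continuous_snd)
            obtain ⟨z, hz, hmin⟩ := (hKc ω).exists_isMinOn hKn hG.continuousOn
            have hle : ∀ m : ℕ, G z ≤ 2 * (1 / ((m:ℝ)+1)) := by
              intro m
              have hm : (0:ℝ) < 1 / ((m:ℝ)+1) := by positivity
              obtain ⟨i, hi1, hi2⟩ := H m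
              obtain ⟨w, hw, hw1⟩ := (infDist_lt_iff hKn).1 hi1
              rw [Prod.dist_eq, max_lt_iff] at hw1
              refine (hmin hw).trans (max_le ?_ ?_)
              · rw [dist_comm]; simp only at hw1; linarith [hw1.1]
              · have := infDist_le_infDist_add_dist (s := C) (x := w.2) (y := q i)
                rw [dist_comm] at this
                simp only at hw1
                linarith [hw1.2]
            have h0 : G z ≤ 0 := by
              refine ge_of_tendsto' (x := atTop) (f := fun m : ℕ => 2 * (1 / ((m:ℝ)+1))) ?_ hle
              simpa using tendsto_one_div_add_atTop_nhds_zero_nat.const_mul (2:ℝ)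
            have h2 : z.1 = ξ := dist_le_zero.1 ((le_max_left _ _).trans h0)
            have h3 : infDist z.2 C ≤ 0 := (le_max_right _ _).trans h0
            have h4 : z.2 ∈ C := (hC.mem_iff_infDist_zero hCn).2 (le_antisymm h3 infDist_nonneg)
            have h5 : z.2 = φ ω ξ := (hφ ω hω ξ).2 z.2 (by rw [← h2]; exact hz)
            show φ ω ξ ∈ C
            rw [← h5]; exact h4
        rw [this]
        simp [hω]
    rw [heq]
    refine (hsm.compl.inter (MeasurableSet.iInter fun m => MeasurableSet.iUnion fun i => ?_)).union
      (hsm.inter (MeasurableSet.const _))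
    exact (measurableSet_lt (hKm _) measurable_const).inter (MeasurableSet.const _)
  · have hs' : ∀ᵐ ω ∂P, ω ∉ s := measure_eq_zero_iff_ae_notMem.1 hs0
    filter_upwards [hs'] with ω hω
    have hgr : K ω = {p | p.2 = φ ω p.1} := by
      ext p
      constructor
      · intro hp; exact (hφ ω hω p.1).2 p.2 hp
      · intro hp
        have h1 := (hφ ω hω p.1).1
        have h2 : p.2 = φ ω p.1 := hp
        rw [← h2] at h1
        exact h1
    refine ⟨?_, hgr⟩
    rw [continuous_iff_isClosed]
    intro C hC
    have : φ ω ⁻¹' C = Prod.fst '' (K ω ∩ Prod.snd ⁻¹' C) := by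
      ext ξ
      constructor
      · intro hξ; exact ⟨(ξ, φ ω ξ), ⟨(hφ ω hω ξ).1, hξ⟩, rfl⟩
      · rintro ⟨p, ⟨hp, hpC⟩, rfl⟩
        show φ ω p.1 ∈ C
        rw [← (hφ ω hω p.1).2 p.2 hp]; exact hpC
    rw [this]
    exact (((hKc ω).inter_right (hC.preimage continuous_snd)).image continuous_fst).isClosed

theorem inv_good {Ω : Type*} [MeasurableSpace Ω] (P : Measure Ω) 
    (θ θinv : Ω → Ω) (hθ : MeasurePreserving θ P P) (hθim : Measurable θinv)
    (hli : Function.LeftInverse θinv θ) (hri : Function.RightInverse θinv θ) (p : Ω → Prop) (hp : ∀ᵐ ω ∂P, p ω) :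
    ∃ G : Set Ω, MeasurableSet G ∧ (∀ᵐ ω ∂P, ω ∈ G) ∧ (∀ ω ∈ G, p ω) ∧ ∀ ω, θ ω ∈ G ↔ ω ∈ G := by
  obtain ⟨s, hs, hsm, hs0⟩ := exists_measurable_superset_of_null (ae_iff.1 hp)
  have hs' : ∀ᵐ ω ∂P, ω ∉ s := measure_eq_zero_iff_ae_notMem.1 hs0
  have hinv : MeasurePreserving θinv P P := by
    refine ⟨hθim, ?_⟩
    conv_lhs => rw [← hθ.map_eq]
    rw [Measure.map_map hθim hθ.measurable, hli.comp_eq_id, Measure.map_id]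
  refine ⟨⋂ n : ℕ, (θ^[n] ⁻¹' sᶜ ∩ θinv^[n] ⁻¹' sᶜ), ?_, ?_, ?_, ?_⟩
  · exact MeasurableSet.iInter fun n => ((hθ.measurable.iterate n) hsm.compl).inter ((hθim.iterate n) hsm.compl)
  · simp only [Set.mem_iInter]
    rw [ae_all_iff]
    intro n
    filter_upwards [(hθ.iterate n).quasiMeasurePreserving.ae hs', (hinv.iterate n).quasiMeasurePreserving.ae hs'] with ω h1 h2
    exact ⟨h1, h2⟩
  · intro ω hω
    have := (Set.mem_iInter.1 hω 0).1
    by_contra hno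
    exact this (hs hno)
  · intro ω
    simp only [Set.mem_iInter]
    constructor
    · intro H n
      constructor
      · cases n with
        | zero => have := (H 1).2; simp only [Function.iterate_one, Set.mem_preimage, hli ω] at this; exact this
        | succ n => exact (H n).1
      · have := (H (n+1)).2
        simp only [Set.mem_preimage, Function.iterate_succ_apply, hli ω] at this
        exact this
    · intro H n
      constructor
      · exact (H (n+1)).1
      · cases n with
        | zero => exact (H 1).1
        | succ n =>
          have := (H n).2
          simp only [Set.mem_preimage, Function.iterate_succ_apply, hli ω] at this ⊢
          exact this

theorem iter_agree {Ω Ξ E : Type*} (θ : Ω → Ω) (g g' : Ω → Ξ → Ξ) (h h' : Ω → Ξ → E → E) (G : Set Ω)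
    (hG : ∀ ω, θ ω ∈ G ↔ ω ∈ G) (hg : ∀ ω ∈ G, g' ω = g ω) (hh : ∀ ω ∈ G, h' ω = h ω)
    (n : ℕ) (ω : Ω) (hω : ω ∈ G) :
    θ^[n] ω ∈ G ∧ giter θ g' n ω = giter θ g n ω ∧ hiter θ g' h' n ω = hiter θ g h n ω := by
  induction n with
  | zero => exact ⟨hω, rfl, rfl⟩
  | succ n ih =>
    obtain ⟨h1, h2, h3⟩ := ih
    refine ⟨?_, ?_, ?_⟩
    · rw [Function.iterate_succ_apply']; exact (hG _).2 h1
    · funext ξ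
      simp only [giter, h2, hg _ h1]
    · funext ξ y
      simp only [hiter, h2, h3, hh _ h1]

theorem iter_off {Ω Ξ E : Type*} (θ : Ω → Ω) (g' : Ω → Ξ → Ξ) (h' : Ω → Ξ → E → E) (G : Set Ω)
    (hG : ∀ ω, θ ω ∈ G ↔ ω ∈ G) (hh : ∀ ω, ω ∉ G → ∀ ξ y, h' ω ξ y = y)
    (n : ℕ) (ω : Ω) (hω : ω ∉ G) :
    θ^[n] ω ∉ G ∧ ∀ ξ, hiter θ g' h' n ω ξ = id := by
  induction n with
  | zero => exact ⟨hω, fun _ => rfl⟩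
  | succ n ih =>
    obtain ⟨h1, h2⟩ := ih
    refine ⟨?_, ?_⟩
    · rw [Function.iterate_succ_apply', hG]; exact h1
    · intro ξ
      funext y
      simp only [hiter, h2, hh _ h1, id]

end Helpers

/-- For a double skew product `T(ω,ξ,y) = (θω, g_ω(ξ), h_{ω,ξ}(y))`
with a `T`-invariant random compact set `K` with connected fibres `K(ω,ξ)`, the
uniform neighbourhood estimate on the `Φ_k`, and negative Lyapunov exponents
`λ(μ,T) < 0` for all `μ ∈ M_P^K(T)`, for `P`-a.e. `ω` the fibre `K(ω)` consists of
a single continuous graph: there is `φ : Ω × Ξ → ℝ^d`, measurable in `ω` and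
continuous in `ξ`, with `K(ω) = {(ξ, φ(ω,ξ)) : ξ ∈ Ξ}` for `P`-a.e. `ω`. -/
theorem stmt10 {Ω Ξ : Type*} [MeasurableSpace Ω] [MetricSpace Ξ] [CompactSpace Ξ]
    [MeasurableSpace Ξ] [BorelSpace Ξ]
    {d : ℕ}
    (P : Measure Ω) [IsProbabilityMeasure P]
    (θ θinv : Ω → Ω) (hθm : Measurable θ) (hθim : Measurable θinv)
    (hli : Function.LeftInverse θinv θ) (hri : Function.RightInverse θinv θ)
    (herg : Ergodic θ P)
    (g : Ω → Ξ → Ξ) (hgc : ∀ ω, Continuous (g ω))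
    (hgb : ∀ ω, Function.Bijective (g ω))
    (hgm : ∀ ξ, Measurable fun ω => g ω ξ)
    (h : Ω → Ξ → EuclideanSpace ℝ (Fin d) → EuclideanSpace ℝ (Fin d))
    (hhc : ∀ ω, Continuous fun p : Ξ × EuclideanSpace ℝ (Fin d) => h ω p.1 p.2)
    (hhd : ∀ ω ξ, Differentiable ℝ (h ω ξ))
    (hhD : ∀ ω, Continuous fun p : Ξ × EuclideanSpace ℝ (Fin d) =>
      fderiv ℝ (h ω p.1) p.2)
    (hhm : ∀ ξ y, Measurable fun ω => h ω ξ y)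
    (K : Set (Ω × Ξ × EuclideanSpace ℝ (Fin d)))
    (hKc : ∀ ω, IsCompact {p : Ξ × EuclideanSpace ℝ (Fin d) | (ω, p) ∈ K})
    (hKm : ∀ p : Ξ × EuclideanSpace ℝ (Fin d),
      Measurable fun ω => infDist p {q : Ξ × EuclideanSpace ℝ (Fin d) | (ω, q) ∈ K})
    (hKinv : ∀ᵐ ω ∂P,
      (fun p : Ξ × EuclideanSpace ℝ (Fin d) => (g ω p.1, h ω p.1 p.2)) ''
        {p | (ω, p) ∈ K} = {p | (θ ω, p) ∈ K})
    (hsup : ∀ k : ℕ, ∀ ε > (0 : ℝ), ∃ r > (0 : ℝ),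
      ∀ ω (p : Ξ × EuclideanSpace ℝ (Fin d)),
        infDist p {q : Ξ × EuclideanSpace ℝ (Fin d) | (ω, q) ∈ K} < r →
          Real.log ‖fderiv ℝ (hiter θ g h k ω p.1) p.2‖ ≤
            (⨆ ω' : Ω, ⨆ q : {q : Ξ × EuclideanSpace ℝ (Fin d) | (ω', q) ∈ K},
              Real.log ‖fderiv ℝ (hiter θ g h k ω' q.1.1) q.1.2‖) + ε)
    (hlyap : ∀ μ : Measure (Ω × Ξ × EuclideanSpace ℝ (Fin d)),
      IsProbabilityMeasure μ →
      μ.map (fun q : Ω × Ξ × EuclideanSpace ℝ (Fin d) =>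
        (θ q.1, g q.1 q.2.1, h q.1 q.2.1 q.2.2)) = μ →
      μ.map Prod.fst = P → μ K = 1 →
      (⨅ n : ℕ, ((n : ℝ) + 1)⁻¹ *
        ∫ q : Ω × Ξ × EuclideanSpace ℝ (Fin d), Real.log ‖fderiv ℝ (hiter θ g h (n + 1) q.1 q.2.1) q.2.2‖ ∂μ) < 0)
    (hconn : ∀ᵐ ω ∂P, ∀ ξ : Ξ, IsConnected {y | (ω, ξ, y) ∈ K}) :
    ∃ φ : Ω → Ξ → EuclideanSpace ℝ (Fin d),
      (∀ ξ, Measurable fun ω => φ ω ξ) ∧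
      ∀ᵐ ω ∂P, Continuous (φ ω) ∧
        {p : Ξ × EuclideanSpace ℝ (Fin d) | (ω, p) ∈ K} =
          {p : Ξ × EuclideanSpace ℝ (Fin d) | p.2 = φ ω p.1} := by
  classical
  rcases isEmpty_or_nonempty Ξ with hΞ | ⟨⟨ξ0⟩⟩
  · refine ⟨fun _ _ => 0, fun _ => measurable_const, Eventually.of_forall fun ω => ⟨continuous_const, ?_⟩⟩
    ext p
    exact isEmptyElim p.1
  let Kf : Ω → Set (Ξ × EuclideanSpace ℝ (Fin d)) := fun ω => {p | (ω, p) ∈ K}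
  obtain ⟨G, hGm, hGae, hGp, hGθ⟩ := inv_good P θ θinv herg.toMeasurePreserving hθim hli hri _ (hKinv.and hconn)
  let g' : Ω → Ξ → Ξ := fun ω => if ω ∈ G then g ω else id
  let h' : Ω → Ξ → EuclideanSpace ℝ (Fin d) → EuclideanSpace ℝ (Fin d) :=
    fun ω => if ω ∈ G then h ω else fun _ y => y
  let K' : Ω → Set (Ξ × EuclideanSpace ℝ (Fin d)) := fun ω => if ω ∈ G then Kf ω else {(ξ0, 0)}
  have hg1 : ∀ ω ∈ G, g' ω = g ω := fun ω hω => if_pos hω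
  have hg0 : ∀ ω, ω ∉ G → g' ω = id := fun ω hω => if_neg hω
  have hh1 : ∀ ω ∈ G, h' ω = h ω := fun ω hω => if_pos hω
  have hh0 : ∀ ω, ω ∉ G → h' ω = fun _ y => y := fun ω hω => if_neg hω
  have hK1 : ∀ ω ∈ G, K' ω = Kf ω := fun ω hω => if_pos hω
  have hK0 : ∀ ω, ω ∉ G → K' ω = {(ξ0, 0)} := fun ω hω => if_neg hω
  have hag : ∀ n, ∀ ω ∈ G, hiter θ g' h' n ω = hiter θ g h n ω := fun n ω hω =>
    (iter_agree θ g g' h h' G hGθ hg1 hh1 n ω hω).2.2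
  have hoff : ∀ n, ∀ ω, ω ∉ G → ∀ ξ, hiter θ g' h' n ω ξ = id := fun n ω hω =>
    (iter_off θ g' h' G hGθ (fun ω hω ξ y => by rw [hh0 ω hω]) n ω hω).2
  have key := coreC P θ θinv hθim hli hri herg g' ?_ ?_ ?_ h' ?_ ?_ ?_ ?_ K' ?_ ?_ ?_ ?_ ?_ ?_ ?_
  · refine graph_of_unique P Kf hKc hKm ?_ ?_
    · filter_upwards [hconn] with ω hω ξ
      exact (hω ξ).nonempty
    · filter_upwards [key, hGae] with ω hω hωG
      rwa [hK1 ω hωG] at hω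
  · intro ω
    by_cases hω : ω ∈ G
    · rw [hg1 ω hω]; exact hgc ω
    · rw [hg0 ω hω]; exact continuous_id
  · intro ω
    by_cases hω : ω ∈ G
    · rw [hg1 ω hω]; exact (hgb ω).1
    · rw [hg0 ω hω]; exact Function.injective_id
  · intro ξ
    have : (fun ω => g' ω ξ) = fun ω => if ω ∈ G then g ω ξ else ξ := by
      funext ω
      by_cases hω : ω ∈ G
      · rw [hg1 ω hω, if_pos hω]
      · rw [hg0 ω hω, if_neg hω]; rfl
    rw [this]
    exact Measurable.ite hGm (hgm ξ) measurable_const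
  · intro ω
    by_cases hω : ω ∈ G
    · rw [hh1 ω hω]; exact hhc ω
    · rw [hh0 ω hω]; exact continuous_snd
  · intro ω ξ
    by_cases hω : ω ∈ G
    · rw [hh1 ω hω]; exact hhd ω ξ
    · rw [hh0 ω hω]; exact differentiable_id
  · intro ω
    by_cases hω : ω ∈ G
    · rw [hh1 ω hω]; exact hhD ω
    · rw [hh0 ω hω]
      simp only [fderiv_fun_id]
      exact continuous_const
  · intro ξ y
    have : (fun ω => h' ω ξ y) = fun ω => if ω ∈ G then h ω ξ y else y := by
      funext ω
      by_cases hω : ω ∈ G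
      · rw [hh1 ω hω, if_pos hω]
      · rw [hh0 ω hω, if_neg hω]
    rw [this]
    exact Measurable.ite hGm (hhm ξ y) measurable_const
  · intro ω
    by_cases hω : ω ∈ G
    · rw [hK1 ω hω]; exact hKc ω
    · rw [hK0 ω hω]; exact isCompact_singleton
  · intro ω
    by_cases hω : ω ∈ G
    · rw [hK1 ω hω]
      obtain ⟨y, hy⟩ := ((hGp ω hω).2 ξ0).nonempty
      exact ⟨(ξ0, y), hy⟩
    · rw [hK0 ω hω]; exact Set.singleton_nonempty _
  · intro p
    have : (fun ω => infDist p (K' ω)) = fun ω => if ω ∈ G then infDist p (Kf ω) else dist p (ξ0, 0) := by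
      funext ω
      by_cases hω : ω ∈ G
      · rw [hK1 ω hω, if_pos hω]
      · rw [hK0 ω hω, if_neg hω, infDist_singleton]
    rw [this]
    exact Measurable.ite hGm (hKm p) measurable_const
  · intro ω
    by_cases hω : ω ∈ G
    · rw [hK1 ω hω, hK1 (θ ω) ((hGθ ω).2 hω), hg1 ω hω, hh1 ω hω]
      exact (hGp ω hω).1
    · rw [hK0 ω hω, hK0 (θ ω) (fun hc => hω ((hGθ ω).1 hc)), hg0 ω hω, hh0 ω hω]
      simp
  · intro ω ξ
    by_cases hω : ω ∈ G
    · rw [hK1 ω hω]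
      exact ((hGp ω hω).2 ξ).isPreconnected
    · rw [hK0 ω hω]
      refine Set.Subsingleton.isPreconnected ?_
      intro y hy y' hy'
      have h1 := congrArg Prod.snd (Set.mem_singleton_iff.1 hy)
      have h2 := congrArg Prod.snd (Set.mem_singleton_iff.1 hy')
      exact h1.trans h2.symm
  · intro k
    obtain ⟨r, hr, hrk⟩ := hsup k 1 one_pos
    set S := (⨆ ω' : Ω, ⨆ q : {q : Ξ × EuclideanSpace ℝ (Fin d) | (ω', q) ∈ K},
              Real.log ‖fderiv ℝ (hiter θ g h k ω' q.1.1) q.1.2‖) with hS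
    refine ⟨r, hr, max (S + 1) 0, fun ω p hp => ?_⟩
    by_cases hω : ω ∈ G
    · rw [hK1 ω hω] at hp
      rw [hag k ω hω]
      have h1 := hrk ω p hp
      rcases (norm_nonneg (fderiv ℝ (hiter θ g h k ω p.1) p.2)).eq_or_lt with h0 | h0
      · rw [← h0]; exact (Real.exp_pos _).le
      · exact (Real.log_le_iff_le_exp h0).1 (h1.trans (le_max_left _ _))
    · rw [hoff k ω hω, fderiv_id]
      exact ContinuousLinearMap.norm_id_le.trans (Real.one_le_exp (le_max_right _ _))
  · intro μ hμ hinv hfst hμK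
    have hGμ : ∀ᵐ q ∂μ, q.1 ∈ G := by
      rw [← hfst] at hGae
      exact ae_of_ae_map measurable_fst.aemeasurable hGae
    by_contra hno
    push Not at hno
    refine absurd (hlyap μ hμ ?_ hfst ?_) (not_lt.2 ?_)
    · conv_rhs => rw [← hinv]
      refine Measure.map_congr ?_
      filter_upwards [hGμ] with q hq
      simp only [skewMap, fibMap, hg1 _ hq, hh1 _ hq]
    · rw [← hμK]
      refine measure_congr ?_
      filter_upwards [hGμ] with q hq
      have : (q ∈ K) = (q.2 ∈ K' q.1) := by rw [hK1 _ hq]; rfl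
      exact this
    · refine Real.iInf_nonneg fun n => mul_nonneg (by positivity) ?_
      have h1 := hno n
      have h2 : ∫ q : Ω × Ξ × EuclideanSpace ℝ (Fin d), Real.log ‖fderiv ℝ (hiter θ g' h' (n + 1) q.1 q.2.1) q.2.2‖ ∂μ
          = ∫ q : Ω × Ξ × EuclideanSpace ℝ (Fin d), Real.log ‖fderiv ℝ (hiter θ g h (n + 1) q.1 q.2.1) q.2.2‖ ∂μ := by
        refine integral_congr_ae ?_
        filter_upwards [hGμ] with q hq
        rw [hag _ _ hq]
      rwa [h2] at h1
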